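/- arXiv:2305.11062 — 5 statements merged into one kernel-verified Lean document; each statement's English description precedes it below -/
import Mathlib

section
/- Let G be an abelian group with no elements of order 2, and let A, B be finite multisets of G. Then the following are equivalent: (i) there exists s ∈ G such that FS(A) = FS(B) + s (equality of multisets, where +s shifts every element); (ii) the function μ := μ_A − μ_B belongs to V(G). -/
open scoped BigOperators

/-- The multiset of all `2^|A|` subset sums of a finite multiset `A`. -/
def FS {G : Type*} [AddCommMonoid G] (A : Multiset G) : Multiset G :=
  A.powerset.map Multiset.sum

/-- `μ : G → ℤ` belongs to `V(G)`. -/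
def memV {G : Type*} [AddCommGroup G] (μ : G → ℤ) : Prop :=
  (Function.support μ).Finite ∧
  (∀ g : G, μ g + μ (-g) = μ (g + g) + μ (-(g + g))) ∧
  (∀ H : AddSubgroup G, ∑ᶠ g ∈ (H : Set G), μ g = 0)

open Filter Topology MeasureTheory

theorem exists_tendsto_sum_div_of_bounded {f : ℕ → ℂ} (hf0 : f 0 = 0) {C : ℝ}
    (hC : ∀ n, ‖∑ k ∈ Finset.Icc 1 n, f k‖ ≤ C) :
    ∃ I : ℂ, Tendsto (fun n ↦ ∑ k ∈ Finset.range n, f k / k) atTop (𝓝 I) ∧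
      Tendsto (fun s : ℝ ↦ LSeries f s) (𝓝[>] 1) (𝓝 I) := by
  have hIcc (n : ℕ) : ∑ k ∈ Finset.Icc 0 n, f k = ∑ k ∈ Finset.Icc 1 n, f k := by
    refine (Finset.sum_subset (Finset.Icc_subset_Icc_left zero_le_one) fun k hk hk' ↦ ?_).symm
    obtain rfl : k = 0 := by
      simp only [Finset.mem_Icc] at hk hk'
      omega
    exact hf0
  have hC0 : 0 ≤ C := (norm_nonneg _).trans (hC 0)
  have hbound (n : ℕ) : ‖f n‖ ≤ 2 * C := by
    rcases n with _ | n
    · simpa [hf0] using hC0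
    · have h := Finset.sum_Icc_succ_top (Nat.succ_le_succ (Nat.zero_le n)) f
      rw [← sub_eq_iff_eq_add'] at h
      rw [← h]
      linarith [norm_sub_le (∑ k ∈ Finset.Icc 1 (n + 1), f k) (∑ k ∈ Finset.Icc 1 n, f k),
        hC (n + 1), hC n]
  set S : ℝ → ℂ := fun t ↦ ∑ k ∈ Finset.Icc 1 ⌊t⌋₊, f k with hS
  refine ⟨∫ t in Set.Ioi (1 : ℝ), S t * (t : ℂ) ^ (-(1 + 1) : ℂ), ?_, ?_⟩
  · have hder : ∀ t ∈ Set.Ici (1 : ℝ), HasDerivAt (fun t : ℝ ↦ (t : ℂ)⁻¹) (-((t : ℂ) ^ 2)⁻¹) t := by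
      intro t ht
      have ht0 : (t : ℂ) ≠ 0 := by
        have : (1 : ℝ) ≤ t := ht
        exact_mod_cast (by linarith : t ≠ 0)
      exact (hasDerivAt_inv ht0).comp_ofReal
    have hcont : ContinuousOn (fun t : ℝ ↦ -((t : ℂ) ^ 2)⁻¹) (Set.Ici 1) := by
      apply ContinuousOn.neg
      apply ContinuousOn.inv₀ (by fun_prop)
      intro t ht
      have : (1 : ℝ) ≤ t := ht
      exact_mod_cast (by positivity : t ^ 2 ≠ 0)
    have key := tendsto_sum_mul_atTop_nhds_one_sub_integral₀ (c := f) (f := fun t : ℝ ↦ (t : ℂ)⁻¹)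
      (l := 0) (g := fun t : ℝ ↦ t ^ (-2 : ℝ)) hf0
      (fun t ht ↦ (hder t ht).differentiableAt) ?_ ?_ ?_ ?_
    · rw [← tendsto_add_atTop_iff_nat 1]
      convert key using 1
      · ext n
        rw [Finset.range_eq_Ico, Finset.Ico_add_one_right_eq_Icc]
        refine Finset.sum_congr rfl fun k _ ↦ ?_
        simp [div_eq_inv_mul]
      · rw [zero_sub, ← integral_neg]
        congr 1
        refine setIntegral_congr_fun measurableSet_Ioi fun t ht ↦ ?_
        have ht' : (1 : ℝ) ≤ t := le_of_lt ht
        simp only [(hder t ht').deriv, hIcc, hS]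
        rw [show (-(1 + 1) : ℂ) = -((2 : ℕ) : ℂ) by norm_num, Complex.cpow_neg,
          Complex.cpow_natCast]
        ring
    · refine (hcont.congr fun t ht ↦ (hder t ht).deriv).locallyIntegrableOn measurableSet_Ici
    · refine squeeze_zero_norm (a := fun n : ℕ ↦ (n : ℝ)⁻¹ * C) (fun n ↦ ?_) ?_
      · rw [hIcc, norm_mul]
        simp only [Complex.ofReal_natCast, norm_inv, Complex.norm_natCast]
        gcongr
        exact hC n
      · simpa using tendsto_inv_atTop_nhds_zero_nat (𝕜 := ℝ).mul_const C
    · refine Asymptotics.IsBigO.of_bound C ?_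
      filter_upwards [eventually_ge_atTop 1] with t ht
      have ht0 : (0 : ℝ) < t := by linarith
      rw [(hder t ht).deriv, hIcc, norm_mul, mul_comm, Real.norm_of_nonneg (by positivity),
        Real.rpow_neg ht0.le]
      gcongr
      · exact hC _
      · simp [abs_of_pos ht0]
    · exact ⟨Set.Ioi 1, Ioi_mem_atTop 1, integrableOn_Ioi_rpow_of_lt (by norm_num) one_pos⟩
  · have h1 : Tendsto (fun s : ℝ ↦ ∫ t in Set.Ioi (1 : ℝ), S t * (t : ℂ) ^ (-((s : ℂ) + 1)))
        (𝓝[>] 1) (𝓝 (∫ t in Set.Ioi (1 : ℝ), S t * (t : ℂ) ^ (-(1 + 1) : ℂ))) := by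
      refine tendsto_integral_filter_of_dominated_convergence (fun t ↦ C * t ^ (-2 : ℝ)) ?_ ?_ ?_ ?_
      · refine Eventually.of_forall fun s ↦ AEStronglyMeasurable.mul ?_ ?_
        · have : Measurable S :=
            (measurable_from_nat (f := fun n ↦ ∑ k ∈ Finset.Icc 1 n, f k)).comp Nat.measurable_floor
          exact this.aestronglyMeasurable
        · refine ContinuousOn.aestronglyMeasurable ?_ measurableSet_Ioi
          intro t ht
          refine ContinuousAt.continuousWithinAt ?_
          refine Complex.continuousAt_ofReal_cpow_const _ _ (Or.inr ?_)
          have : (1 : ℝ) < t := ht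
          linarith
      · filter_upwards [self_mem_nhdsWithin] with s hs
        refine (ae_restrict_iff' measurableSet_Ioi).mpr (Eventually.of_forall fun t ht ↦ ?_)
        have ht1 : (1 : ℝ) < t := ht
        have hs1 : (1 : ℝ) < s := hs
        rw [norm_mul, Complex.norm_cpow_eq_rpow_re_of_pos (by linarith)]
        gcongr
        · exact hC _
        · exact ht1.le
        · simp; linarith
      · exact (integrableOn_Ioi_rpow_of_lt (by norm_num) one_pos).const_mul C
      · refine (ae_restrict_iff' measurableSet_Ioi).mpr (Eventually.of_forall fun t ht ↦ ?_)
        have ht1 : (1 : ℝ) < t := ht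
        refine Tendsto.const_mul _ ?_
        have ht0 : (t : ℂ) ≠ 0 := by exact_mod_cast (by linarith : t ≠ 0)
        have : ContinuousAt (fun s : ℝ ↦ (t : ℂ) ^ (-((s : ℂ) + 1))) 1 := by
          refine ContinuousAt.const_cpow (by fun_prop) (Or.inl ht0)
        simpa using this.tendsto.mono_left nhdsWithin_le_nhds
    have h2 : Tendsto (fun s : ℝ ↦ (s : ℂ)) (𝓝[>] 1) (𝓝 1) := by
      simpa using (Complex.continuous_ofReal.tendsto 1).mono_left nhdsWithin_le_nhds
    have h3 := h2.mul h1
    rw [one_mul] at h3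
    refine h3.congr' ?_
    filter_upwards [self_mem_nhdsWithin] with s hs
    have hs1 : (1 : ℝ) < s := hs
    refine (LSeries_eq_mul_integral f (r := 0) le_rfl (by simp; linarith) ?_ ?_).symm
    · exact LSeriesSummable_of_bounded_of_one_lt_re (fun n _ ↦ hbound n) (by simpa using hs1)
    · refine Asymptotics.IsBigO.of_bound C (Eventually.of_forall fun n ↦ ?_)
      simpa using hC n

theorem tendsto_sum_pow_div {z : ℂ} (hz : ‖z‖ = 1) (hz1 : z ≠ 1) :
    Tendsto (fun n ↦ ∑ k ∈ Finset.range n, z ^ k / k) atTop (𝓝 (-Complex.log (1 - z))) := by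
  have hsub : z - 1 ≠ 0 := sub_ne_zero.mpr hz1
  have hb (n : ℕ) : ‖∑ k ∈ Finset.Icc 1 n, if k = 0 then 0 else z ^ k‖ ≤ 2 / ‖z - 1‖ := by
    have h : ∑ k ∈ Finset.Icc 1 n, (if k = 0 then 0 else z ^ k) = (z ^ (n + 1) - z) / (z - 1) := by
      rw [eq_div_iff hsub]
      induction n with
      | zero => simp
      | succ n ih =>
        rw [Finset.sum_Icc_succ_top (by omega), add_mul, ih, if_neg (Nat.succ_ne_zero n)]
        ring
    rw [h, norm_div]
    gcongr
    refine (norm_sub_le _ _).trans ?_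
    rw [norm_pow, hz]
    norm_num
  obtain ⟨l, hl, -⟩ := exists_tendsto_sum_div_of_bounded (by simp) hb
  have hl' : Tendsto (fun n ↦ ∑ k ∈ Finset.range n, z ^ k / k) atTop (𝓝 l) := by
    refine hl.congr fun n ↦ Finset.sum_congr rfl fun k _ ↦ ?_
    rcases eq_or_ne k 0 with rfl | hk
    · simp
    · simp [hk]
  have h1 := tendsto_map'_iff.mp (Complex.tendsto_tsum_powerSeries_nhdsWithin_lt hl')
  have hre : z.re < 1 := by
    refine lt_of_le_of_ne (hz ▸ Complex.re_le_norm z) fun h ↦ hz1 ?_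
    have := Complex.sq_norm z
    rw [hz, Complex.normSq_apply, h] at this
    apply Complex.ext
    · simpa using h
    · simpa using (by nlinarith : z.im * z.im = 0)
  have h2 : Tendsto (fun r : ℝ ↦ -Complex.log (1 - r * z)) (𝓝[<] 1)
      (𝓝 (-Complex.log (1 - z))) := by
    have : ContinuousAt (fun r : ℝ ↦ -Complex.log (1 - r * z)) 1 := by
      refine (ContinuousAt.clog (by fun_prop) ?_).neg
      refine Complex.mem_slitPlane_iff.mpr (Or.inl ?_)
      simpa using hre
    simpa using this.tendsto.mono_left nhdsWithin_le_nhds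
  have heq : (fun r : ℝ ↦ -Complex.log (1 - r * z)) =ᶠ[𝓝[<] 1]
      (fun z' : ℂ ↦ ∑' n : ℕ, z ^ n / n * z' ^ n) ∘ Complex.ofReal := by
    filter_upwards [Ioo_mem_nhdsLT (zero_lt_one (α := ℝ))] with r hr
    have hlt : ‖(r : ℂ) * z‖ < 1 := by
      rw [norm_mul, hz, mul_one, Complex.norm_real, Real.norm_of_nonneg hr.1.le]
      exact hr.2
    rw [← (Complex.hasSum_taylorSeries_neg_log hlt).tsum_eq]
    refine tsum_congr fun n ↦ ?_
    rw [mul_pow]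
    ring
  rwa [tendsto_nhds_unique (h2.congr' heq) h1]

theorem norm_sum_range_zmod_le {N : ℕ} [NeZero N] (f : ZMod N → ℂ) (hf : ∑ a, f a = 0) :
    ∃ C : ℝ, ∀ n, ‖∑ k ∈ Finset.range n, f (k : ZMod N)‖ ≤ C := by
  have hper : Function.Periodic (fun n ↦ ∑ k ∈ Finset.range n, f (k : ZMod N)) N := by
    intro n
    induction n with
    | zero =>
      simp only [zero_add, Finset.range_zero, Finset.sum_empty]
      rw [← hf, Finset.sum_range]
      obtain ⟨m, rfl⟩ : ∃ m, N = m + 1 := Nat.exists_eq_succ_of_ne_zero (NeZero.ne N)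
      refine Finset.sum_congr rfl fun a _ ↦ congrArg f ?_
      exact Fin.cast_val_eq_self a
    | succ n ih =>
      simp only at ih ⊢
      rw [show n + 1 + N = n + N + 1 by ring, Finset.sum_range_succ, ih, Finset.sum_range_succ]
      simp
  obtain ⟨C, hC⟩ := ((Finset.range N).image
    fun n ↦ ‖∑ k ∈ Finset.range n, f (k : ZMod N)‖).bddAbove
  refine ⟨C, fun n ↦ ?_⟩
  rw [← hper.map_mod_nat n]
  exact hC (Finset.mem_coe.mpr (Finset.mem_image_of_mem _
    (Finset.mem_range.mpr (Nat.mod_lt n (NeZero.pos N)))))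

theorem DirichletCharacter.not_tendsto_sum_div_zero {N : ℕ} [NeZero N]
    {ψ : DirichletCharacter ℂ N} (hψ : ψ ≠ 1) :
    ¬ Tendsto (fun n ↦ ∑ k ∈ Finset.range n, ψ k / k) atTop (𝓝 0) := by
  intro h
  have hN : N ≠ 1 := by
    rintro rfl
    exact hψ (DirichletCharacter.level_one ψ)
  have h0 : ψ ((0 : ℕ) : ZMod N) = 0 := by
    have : Fact (1 < N) := ⟨by have := NeZero.pos N; omega⟩
    simpa using MulChar.map_zero ψ
  obtain ⟨C, hC⟩ := norm_sum_range_zmod_le ψ (MulChar.sum_eq_zero_of_ne_one hψ)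
  obtain ⟨l, hl, hL⟩ := exists_tendsto_sum_div_of_bounded (f := fun k : ℕ ↦ ψ k) h0 (C := C) (by
    intro n
    have h1 := hC (n + 1)
    rw [Finset.sum_range_succ', h0, add_zero] at h1
    convert h1 using 2
    rw [Finset.range_eq_Ico, Finset.sum_Ico_add' (fun k : ℕ ↦ ψ k) 0 n 1]
    rfl)
  obtain rfl := tendsto_nhds_unique hl h
  refine ψ.LFunction_apply_one_ne_zero hψ (tendsto_nhds_unique ?_ hL)
  have hc : Tendsto (fun s : ℝ ↦ ψ.LFunction s) (𝓝[>] 1) (𝓝 (ψ.LFunction 1)) := by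
    have := ((DirichletCharacter.differentiable_LFunction hψ).continuous.comp
      Complex.continuous_ofReal).tendsto 1
    simpa [Function.comp_def] using this.mono_left nhdsWithin_le_nhds
  refine hc.congr' ?_
  filter_upwards [self_mem_nhdsWithin] with s hs
  exact ψ.LFunction_eq_LSeries (by simpa using hs)

theorem eq_zero_of_forall_tendsto_sum_div {n : ℕ} [NeZero n] {F : ZMod n → ℂ}
    (hF : ∀ a, ¬IsUnit a → F a = 0) (hsum : ∑ a, F a = 0)
    (hlim : ∀ u : (ZMod n)ˣ,
      Tendsto (fun m ↦ ∑ k ∈ Finset.range m, F (u * (k : ZMod n)) / k) atTop (𝓝 0))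
    (a : ZMod n) : F a = 0 := by
  have hunits (f : ZMod n → ℂ) (hf : ∀ a, ¬IsUnit a → f a = 0) :
      ∑ u : (ZMod n)ˣ, f u = ∑ a, f a := by
    refine Fintype.sum_of_injective (fun u : (ZMod n)ˣ ↦ (u : ZMod n)) Units.val_injective _ _
      (fun a ha ↦ hf a fun hu ↦ ha ?_) fun _ ↦ rfl
    exact ⟨hu.unit, rfl⟩
  have hc (ψ : DirichletCharacter ℂ n) : ∑ a, ψ a * F a = 0 := by
    rcases eq_or_ne ψ 1 with rfl | hψ
    · rw [← hsum]
      refine Finset.sum_congr rfl fun a _ ↦ ?_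
      by_cases ha : IsUnit a
      · rw [MulChar.one_apply ha, one_mul]
      · rw [hF a ha, mul_zero]
    · by_contra hne
      set c := ∑ a, ψ a * F a with hcdef
      have hid (b : ZMod n) : ∑ u : (ZMod n)ˣ, ψ u * F (u * b) = c * ψ⁻¹ b := by
        by_cases hb : IsUnit b
        · obtain ⟨v, rfl⟩ := hb
          rw [hcdef, ← hunits (fun a ↦ ψ a * F a) (fun a ha ↦ by simp [hF a ha]), Finset.sum_mul,
            ← Equiv.sum_comp (Equiv.mulRight v)
              (fun u : (ZMod n)ˣ ↦ ψ (u : ZMod n) * F u * ψ⁻¹ (v : ZMod n))]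
          refine Finset.sum_congr rfl fun u _ ↦ ?_
          have hv : ψ v * ψ⁻¹ v = 1 := by
            rw [← MulChar.mul_apply, mul_inv_cancel, MulChar.one_apply_coe]
          simp only [Equiv.coe_mulRight, Units.val_mul, map_mul]
          linear_combination (-ψ u * F (u * v)) * hv
        · rw [MulChar.map_nonunit _ hb, mul_zero]
          refine Finset.sum_eq_zero fun u _ ↦ ?_
          rw [hF _ (by rwa [Units.isUnit_units_mul]), mul_zero]
      refine DirichletCharacter.not_tendsto_sum_div_zero (inv_ne_one.mpr hψ) ?_
      have h := (tendsto_finsetSum Finset.univ fun u _ ↦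
        (hlim u).const_mul (ψ (u : ZMod n))).const_mul c⁻¹
      simp only [mul_zero, Finset.sum_const_zero] at h
      refine h.congr fun m ↦ ?_
      simp_rw [Finset.mul_sum]
      rw [Finset.sum_comm]
      refine Finset.sum_congr rfl fun k _ ↦ ?_
      rw [eq_comm, ← inv_mul_cancel_left₀ hne (ψ⁻¹ (k : ZMod n)), ← hid, Finset.mul_sum,
        Finset.sum_div]
      exact Finset.sum_congr rfl fun u _ ↦ by ring
  by_cases ha : IsUnit a
  · have h : ∑ b, (∑ ψ : DirichletCharacter ℂ n, ψ a⁻¹ * ψ b) * F b = 0 := by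
      simp_rw [Finset.sum_mul]
      rw [Finset.sum_comm]
      refine Finset.sum_eq_zero fun ψ _ ↦ ?_
      simp_rw [mul_assoc]
      rw [← Finset.mul_sum, hc, mul_zero]
    simp_rw [DirichletCharacter.sum_char_inv_mul_char_eq ℂ ha] at h
    simpa [(Nat.totient_pos.mpr (NeZero.pos n)).ne'] using h
  · exact hF a ha

theorem sum_range_log_norm_one_add_pow {z : ℂ} {K : ℕ} (hK : z ^ 2 ^ K = z) :
    ∑ k ∈ Finset.range K, Real.log ‖1 + z ^ 2 ^ k‖ = if z = 1 then K * Real.log 2 else 0 := by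
  split_ifs with hz
  · simp [hz, one_add_one_eq_two]
  · have hne (k : ℕ) (hk : k ≤ K) : 1 - z ^ 2 ^ k ≠ 0 := by
      rw [sub_ne_zero]
      intro h
      apply hz
      rw [← hK, ← Nat.sub_add_cancel hk, pow_add, mul_comm, pow_mul, ← h, one_pow]
    have hterm : ∀ k ∈ Finset.range K, Real.log ‖1 + z ^ 2 ^ k‖ =
        Real.log ‖1 - z ^ 2 ^ (k + 1)‖ - Real.log ‖1 - z ^ 2 ^ k‖ := by
      intro k hk
      rw [Finset.mem_range] at hk
      have h1 := hne k hk.le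
      have h2 := hne (k + 1) hk
      have hmul : 1 - z ^ 2 ^ (k + 1) = (1 + z ^ 2 ^ k) * (1 - z ^ 2 ^ k) := by ring
      have h3 : 1 + z ^ 2 ^ k ≠ 0 := fun h ↦ h2 (by rw [hmul, h, zero_mul])
      rw [hmul, norm_mul, Real.log_mul (norm_ne_zero_iff.mpr h3) (norm_ne_zero_iff.mpr h1)]
      ring
    rw [Finset.sum_congr rfl hterm,
      Finset.sum_range_sub (fun k ↦ Real.log ‖1 - z ^ 2 ^ k‖), hK]
    simp

theorem add_self_injective {G : Type*} [AddCommGroup G] (h2 : ∀ g : G, g + g = 0 → g = 0) :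
    Function.Injective fun g : G ↦ g + g :=
  fun a b hab ↦ sub_eq_zero.mp (h2 _ (by rw [sub_add_sub_comm, sub_eq_zero.mpr hab]))

theorem odd_card_of_no_two_torsion {G : Type*} [AddCommGroup G] [Finite G]
    (h2 : ∀ g : G, g + g = 0 → g = 0) : Odd (Nat.card G) := by
  rw [← Nat.not_even_iff_odd, even_iff_two_dvd]
  intro h
  obtain ⟨g, hg⟩ := exists_prime_addOrderOf_dvd_card' 2 h
  have : g = 0 := h2 g (by rw [← two_nsmul, ← hg, addOrderOf_nsmul_eq_zero])
  simp [this] at hg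

section AddChar

variable {G : Type*} [AddCommGroup G]

theorem addChar_apply_pow_card (χ : AddChar G ℂ) (g : G) : χ g ^ Nat.card G = 1 := by
  rw [← AddChar.map_nsmul_eq_pow, card_nsmul_eq_zero', AddChar.map_zero_eq_one]

theorem addChar_pow_card (χ : AddChar G ℂ) : χ ^ Nat.card G = 1 := by
  ext g
  simpa using addChar_apply_pow_card χ g

theorem addChar_norm_apply [Finite G] (χ : AddChar G ℂ) (g : G) : ‖χ g‖ = 1 :=
  Complex.norm_eq_one_of_pow_eq_one (addChar_apply_pow_card χ g) Nat.card_pos.ne'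

theorem addChar_apply_pow_two_pow_totient (hodd : Odd (Nat.card G)) (χ : AddChar G ℂ) (g : G) :
    χ g ^ 2 ^ (Nat.card G).totient = χ g := by
  have h := Nat.ModEq.pow_totient (Nat.coprime_two_left.mpr hodd)
  rw [pow_eq_pow_mod _ (addChar_apply_pow_card χ g), h,
    ← pow_eq_pow_mod _ (addChar_apply_pow_card χ g), pow_one]

theorem addChar_one_add_ne_zero (hodd : Odd (Nat.card G)) (χ : AddChar G ℂ) (g : G) :
    1 + χ g ≠ 0 := by
  intro h
  have h1 : χ g = -1 := by linear_combination h
  have h3 := addChar_apply_pow_card χ g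
  rw [h1, hodd.neg_one_pow] at h3
  norm_num at h3

end AddChar

section FiniteGroup

variable {G : Type*} [AddCommGroup G] [Fintype G]

theorem eq_of_forall_sum_mul_addChar_eq {μ ν : G → ℂ}
    (h : ∀ χ : AddChar G ℂ, ∑ g, μ g * χ g = ∑ g, ν g * χ g) : μ = ν := by
  classical
  have key (f : G → ℂ) (x : G) :
      ∑ χ : AddChar G ℂ, χ (-x) * ∑ g, f g * χ g = Fintype.card G * f x := by
    simp_rw [Finset.mul_sum]
    rw [Finset.sum_comm]
    have (g : G) : ∑ χ : AddChar G ℂ, χ (-x) * (f g * χ g)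
        = f g * if g = x then (Fintype.card G : ℂ) else 0 := by
      rw [← sub_eq_zero (a := g), ← AddChar.sum_apply_eq_ite, Finset.mul_sum]
      refine Finset.sum_congr rfl fun χ _ ↦ ?_
      rw [sub_eq_neg_add, AddChar.map_add_eq_mul]
      ring
    simp [this, mul_comm]
  ext x
  have h1 := key μ x
  simp_rw [h, key ν x] at h1
  have hcard : (Fintype.card G : ℂ) ≠ 0 := by exact_mod_cast Fintype.card_ne_zero
  exact (mul_left_cancel₀ hcard h1).symm

/-- The logarithm of the modulus of `∏ g, (1 + χ g) ^ μ g`. -/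
noncomputable def logNorm (μ : G → ℝ) (χ : AddChar G ℂ) : ℝ :=
  ∑ g, μ g * Real.log ‖1 + χ g‖

open Classical in
/-- The sum of `μ` over the kernel of `χ`. -/
noncomputable def kerSum (μ : G → ℝ) (χ : AddChar G ℂ) : ℝ :=
  ∑ g, if χ g = 1 then μ g else 0

theorem sum_logNorm_pow_two_pow (hodd : Odd (Nat.card G)) (μ : G → ℝ) (χ : AddChar G ℂ) :
    ∑ k ∈ Finset.range (Nat.card G).totient, logNorm μ (χ ^ 2 ^ k) =
      (Nat.card G).totient * Real.log 2 * kerSum μ χ := by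
  simp only [logNorm, kerSum, AddChar.pow_apply]
  rw [Finset.sum_comm, Finset.mul_sum]
  refine Finset.sum_congr rfl fun g _ ↦ ?_
  rw [← Finset.mul_sum,
    sum_range_log_norm_one_add_pow (addChar_apply_pow_two_pow_totient hodd χ g)]
  split_ifs <;> ring

theorem kerSum_eq_zero (hodd : Odd (Nat.card G)) {μ : G → ℝ} (hE : ∀ χ, logNorm μ χ = 0)
    (χ : AddChar G ℂ) : kerSum μ χ = 0 := by
  have h := sum_logNorm_pow_two_pow hodd μ χ
  have hφ : ((Nat.card G).totient : ℝ) ≠ 0 := by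
    exact_mod_cast (Nat.totient_pos.mpr Nat.card_pos).ne'
  have hl : Real.log 2 ≠ 0 := (Real.log_pos one_lt_two).ne'
  simpa [hE, hφ, hl] using h.symm

/-- The Fourier coefficient of `μ` at `χ`. -/
noncomputable def charSum (μ : G → ℝ) (χ : AddChar G ℂ) : ℂ :=
  ∑ g, μ g * χ g

theorem sum_range_charSum_pow {χ : AddChar G ℂ} {n : ℕ} (hn : χ ^ n = 1) (μ : G → ℝ) :
    ∑ j ∈ Finset.range n, charSum μ (χ ^ j) = n * kerSum μ χ := by
  simp only [charSum, kerSum, AddChar.pow_apply, Complex.ofReal_sum]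
  rw [Finset.sum_comm, Finset.mul_sum]
  refine Finset.sum_congr rfl fun g _ ↦ ?_
  rw [← Finset.mul_sum]
  split_ifs with h
  · simp [h, mul_comm]
  · rw [geom_sum_eq h, ← AddChar.pow_apply, hn]
    simp

theorem sum_units_charSum_pow_eq_zero {μ : G → ℝ} (hμ : ∀ χ, kerSum μ χ = 0) (χ : AddChar G ℂ) :
    ∑ u : (ZMod (Nat.card G))ˣ, charSum μ (χ ^ (u : ZMod (Nat.card G)).val) = 0 := by
  have : NeZero (Nat.card G) := ⟨Nat.card_pos.ne'⟩
  set N := Nat.card G with hN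
  let M : AddChar G ℂ → ℂ := fun χ ↦ ∑ u : (ZMod N)ˣ, charSum μ (χ ^ (u : ZMod N).val)
  change M χ = 0
  induction hm : orderOf χ using Nat.strong_induction_on generalizing χ with
  | _ m ih =>
    have hmN : m ∣ N := hm ▸ orderOf_dvd_of_pow_eq_one (addChar_pow_card χ)
    have hm0 : 0 < m := Nat.pos_of_dvd_of_pos hmN (NeZero.pos N)
    have hsum : ∑ j ∈ Finset.range m, M (χ ^ j) = 0 := by
      simp only [M]
      rw [Finset.sum_comm]
      refine Finset.sum_eq_zero fun u _ ↦ ?_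
      rw [Finset.sum_congr rfl fun j _ ↦ by rw [pow_right_comm], sum_range_charSum_pow, hμ]
      · simp
      · rw [pow_right_comm, ← hm, pow_orderOf_eq_one, one_pow]
    have hval : ∀ j ∈ Finset.range m, M (χ ^ j) = if m.Coprime j then M χ else 0 := by
      intro j hj
      split_ifs with hcop
      · obtain ⟨v, hv⟩ := ZMod.unitsMap_surjective hmN (ZMod.unitOfCoprime j hcop.symm)
        have hvj : χ ^ j = χ ^ (v : ZMod N).val := by
          rw [pow_eq_pow_iff_modEq, hm, ← ZMod.natCast_eq_natCast_iff]
          have := congrArg Units.val hv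
          simp only [ZMod.unitsMap_val, ZMod.coe_unitOfCoprime] at this
          rw [← this, ZMod.natCast_val]
        simp only [M, hvj]
        rw [← Equiv.sum_comp (Equiv.mulLeft v)
          (fun u : (ZMod N)ˣ ↦ charSum μ (χ ^ (u : ZMod N).val))]
        refine Finset.sum_congr rfl fun u _ ↦ ?_
        rw [← pow_mul, Equiv.coe_mulLeft, Units.val_mul, ZMod.val_mul,
          ← pow_eq_pow_mod _ (addChar_pow_card χ)]
      · refine ih _ ?_ (χ ^ j) rfl
        rw [← hm, orderOf_pow, hm]
        refine Nat.div_lt_self hm0 ?_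
        have := Nat.gcd_pos_of_pos_left j hm0
        have : m.gcd j ≠ 1 := hcop
        omega
    rw [Finset.sum_congr rfl hval, ← Finset.sum_filter, Finset.sum_const,
      ← Nat.totient_eq_card_coprime, nsmul_eq_mul, mul_eq_zero] at hsum
    exact hsum.resolve_left (by exact_mod_cast (Nat.totient_pos.mpr hm0).ne')

theorem apply_zero_eq_zero_of_kerSum {μ : G → ℝ} (hμ : ∀ χ, kerSum μ χ = 0) : μ 0 = 0 := by
  classical
  have : NeZero (Nat.card G) := ⟨Nat.card_pos.ne'⟩
  have hsum : ∑ χ, charSum μ χ = Fintype.card G * μ 0 := by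
    simp only [charSum]
    rw [Finset.sum_comm]
    simp_rw [← Finset.mul_sum, AddChar.sum_apply_eq_ite]
    simp [mul_comm]
  have hM : ∑ χ : AddChar G ℂ, ∑ u : (ZMod (Nat.card G))ˣ,
      charSum μ (χ ^ (u : ZMod (Nat.card G)).val) = 0 :=
    Finset.sum_eq_zero fun χ _ ↦ sum_units_charSum_pow_eq_zero hμ χ
  rw [Finset.sum_comm] at hM
  have hu (u : (ZMod (Nat.card G))ˣ) :
      ∑ χ : AddChar G ℂ, charSum μ (χ ^ (u : ZMod (Nat.card G)).val) = ∑ χ, charSum μ χ := by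
    have hcard : Nat.card (AddChar G ℂ) = Nat.card G := by
      rw [Nat.card_eq_fintype_card, AddChar.card_eq, Nat.card_eq_fintype_card]
    exact Equiv.sum_comp
      (powCoprime (by rw [hcard]; exact (ZMod.val_coe_unit_coprime u).symm)) (charSum μ)
  simp only [hu, hsum, Finset.sum_const, nsmul_eq_mul, mul_eq_zero] at hM
  simpa using hM

end FiniteGroup

theorem tendsto_sum_re_sq_sub_div {z : ℂ} (hz : ‖z‖ = 1) (hz1 : 1 + z ≠ 0) :
    Tendsto (fun m ↦ ∑ k ∈ Finset.range m, (((z ^ k) ^ 2).re - (z ^ k).re) / k) atTop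
      (𝓝 ((if z = 1 then Real.log 2 else 0) - Real.log ‖1 + z‖)) := by
  have hre {w : ℂ} (hw : ‖w‖ = 1) (hw1 : w ≠ 1) :
      Tendsto (fun m ↦ ∑ k ∈ Finset.range m, (w ^ k).re / k) atTop
        (𝓝 (-Real.log ‖1 - w‖)) := by
    have h := (Complex.continuous_re.tendsto _).comp (tendsto_sum_pow_div hw hw1)
    rw [Complex.neg_re, Complex.log_re] at h
    refine h.congr fun m ↦ ?_
    simp [Complex.re_sum, Complex.div_natCast_re]
  split_ifs with h
  · simp [h, one_add_one_eq_two]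
  · have hsub : 1 - z ≠ 0 := sub_ne_zero.mpr (Ne.symm h)
    have hfac : 1 - z ^ 2 = (1 + z) * (1 - z) := by ring
    have hsq : z ^ 2 ≠ 1 := fun h' ↦ mul_ne_zero hz1 hsub (by rw [← hfac, h', sub_self])
    have h2 := (hre (w := z ^ 2) (by rw [norm_pow, hz, one_pow]) hsq).sub (hre hz h)
    rw [hfac, norm_mul, Real.log_mul (norm_ne_zero_iff.mpr hz1) (norm_ne_zero_iff.mpr hsub)] at h2
    convert h2 using 2
    · rw [← Finset.sum_sub_distrib]
      refine Finset.sum_congr rfl fun k _ ↦ ?_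
      rw [pow_right_comm, sub_div]
    · ring

section FiniteGroup

variable {G : Type*} [AddCommGroup G] [Fintype G]

theorem tendsto_sum_charSum_sq_sub_div (hodd : Odd (Nat.card G)) {μ : G → ℝ}
    (hE : ∀ χ, logNorm μ χ = 0) (χ : AddChar G ℂ) :
    Tendsto (fun m ↦ ∑ k ∈ Finset.range m,
      ((charSum μ ((χ ^ k) ^ 2)).re - (charSum μ (χ ^ k)).re) / k) atTop (𝓝 0) := by
  have h := tendsto_finsetSum Finset.univ fun g _ ↦ (tendsto_sum_re_sq_sub_div
    (addChar_norm_apply χ g) (addChar_one_add_ne_zero hodd χ g)).const_mul (μ g)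
  have hlim : ∑ g, μ g * ((if χ g = 1 then Real.log 2 else 0) - Real.log ‖1 + χ g‖) = 0 := by
    have h1 := kerSum_eq_zero hodd hE χ
    have h2 := hE χ
    simp only [kerSum, logNorm] at h1 h2
    simp_rw [mul_sub]
    have h3 : ∑ g, μ g * (if χ g = 1 then Real.log 2 else 0) =
        Real.log 2 * ∑ g, (if χ g = 1 then μ g else 0) := by
      rw [Finset.mul_sum]
      exact Finset.sum_congr rfl fun g _ ↦ by split_ifs <;> ring
    rw [Finset.sum_sub_distrib, h2, sub_zero, h3, h1, mul_zero]
  rw [hlim] at h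
  refine h.congr fun m ↦ ?_
  simp_rw [Finset.mul_sum]
  rw [Finset.sum_comm]
  refine Finset.sum_congr rfl fun k _ ↦ ?_
  simp only [charSum, Complex.re_sum, AddChar.pow_apply, Complex.re_ofReal_mul]
  rw [← Finset.sum_sub_distrib, Finset.sum_div]
  exact Finset.sum_congr rfl fun g _ ↦ by ring

theorem charSum_sq_re_eq (hodd : Odd (Nat.card G)) {μ : G → ℝ}
    (hE : ∀ χ, logNorm μ χ = 0) (χ : AddChar G ℂ) :
    (charSum μ (χ ^ 2)).re = (charSum μ χ).re := by
  induction hn : orderOf χ using Nat.strong_induction_on generalizing χ with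
  | _ n ih =>
    have hn0 : 0 < n := hn ▸ orderOf_pos χ
    have : NeZero n := ⟨hn0.ne'⟩
    let D : AddChar G ℂ → ℝ := fun χ ↦ (charSum μ (χ ^ 2)).re - (charSum μ χ).re
    have hpow : χ ^ n = 1 := hn ▸ pow_orderOf_eq_one χ
    have hval (k : ℕ) : χ ^ (k : ZMod n).val = χ ^ k := by
      rw [ZMod.val_natCast, ← pow_eq_pow_mod _ hpow]
    have key := eq_zero_of_forall_tendsto_sum_div
      (F := fun a : ZMod n ↦ (D (χ ^ a.val) : ℂ)) ?_ ?_ ?_ 1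
    · have h1 : χ ^ (1 : ZMod n).val = χ := by simpa using hval 1
      simpa [h1, D, sub_eq_zero] using key
    · intro a ha
      rw [Complex.ofReal_eq_zero]
      refine sub_eq_zero.mpr (ih _ ?_ _ rfl)
      rw [orderOf_pow, hn]
      refine Nat.div_lt_self hn0 ?_
      have hpos := Nat.gcd_pos_of_pos_left a.val hn0
      have hne : n.gcd a.val ≠ 1 := by
        intro h
        apply ha
        rw [← ZMod.natCast_zmod_val a, ZMod.isUnit_iff_coprime]
        exact Nat.Coprime.symm h
      omega
    · have hrange : ∑ a : ZMod n, (D (χ ^ a.val) : ℂ) =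
          ∑ j ∈ Finset.range n, (D (χ ^ j) : ℂ) := by
        rw [Finset.sum_range]
        obtain ⟨m, rfl⟩ : ∃ m, n = m + 1 := Nat.exists_eq_succ_of_ne_zero hn0.ne'
        rfl
      rw [hrange, ← Complex.ofReal_sum, Complex.ofReal_eq_zero, Finset.sum_sub_distrib,
        ← Complex.re_sum, ← Complex.re_sum, sum_range_charSum_pow hpow,
        Finset.sum_congr rfl fun j _ ↦ by rw [pow_right_comm],
        sum_range_charSum_pow (by rw [pow_right_comm, hpow, one_pow])]
      simp [kerSum_eq_zero hodd hE]
    · intro u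
      have h := (Complex.continuous_ofReal.tendsto _).comp
        (tendsto_sum_charSum_sq_sub_div hodd hE (χ ^ (u : ZMod n).val))
      rw [Complex.ofReal_zero] at h
      refine h.congr fun m ↦ ?_
      simp only [Function.comp_apply, Complex.ofReal_sum, Complex.ofReal_div,
        Complex.ofReal_natCast]
      refine Finset.sum_congr rfl fun k _ ↦ ?_
      have : χ ^ ((u : ZMod n) * (k : ZMod n)).val = (χ ^ (u : ZMod n).val) ^ k := by
        rw [← pow_mul, ← hval (_ * k), Nat.cast_mul, ZMod.natCast_zmod_val]
      simp [D, this]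

theorem apply_add_self_eq (h2 : ∀ g : G, g + g = 0 → g = 0) {ν : G → ℝ}
    (hν : ∀ g, ν (-g) = ν g) (hE : ∀ χ, logNorm ν χ = 0) (g : G) : ν (g + g) = ν g := by
  have hodd := odd_card_of_no_two_torsion h2
  have him (χ : AddChar G ℂ) : ((charSum ν χ).re : ℂ) = charSum ν χ := by
    rw [← Complex.conj_eq_iff_re]
    simp only [charSum, map_sum, map_mul, Complex.conj_ofReal]
    rw [← Equiv.sum_comp (Equiv.neg G)]
    refine Finset.sum_congr rfl fun g _ ↦ ?_
    rw [Equiv.neg_apply, hν, AddChar.map_neg_eq_conj, Complex.conj_conj]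
  have hinj := add_self_injective h2
  let d : G ≃ G := Equiv.ofBijective _ (Finite.injective_iff_bijective.mp hinj)
  have hd (g : G) : d g = g + g := rfl
  have h := eq_of_forall_sum_mul_addChar_eq (μ := fun g ↦ (ν g : ℂ))
    (ν := fun g ↦ (ν (d.symm g) : ℂ)) fun χ ↦ by
      rw [← Equiv.sum_comp d (fun g ↦ (ν (d.symm g) : ℂ) * χ g)]
      change charSum ν χ = _
      rw [← him χ, ← charSum_sq_re_eq hodd hE, him]
      refine Finset.sum_congr rfl fun g _ ↦ ?_
      rw [d.symm_apply_apply, hd, AddChar.map_add_eq_mul, AddChar.pow_apply, sq]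
  have h' := congrFun h (d g)
  simp only [d.symm_apply_apply] at h'
  exact_mod_cast h'

end FiniteGroup

section SubsetSums

variable {G H : Type*} [AddCommGroup G] [AddCommGroup H]

theorem FS_zero : FS (0 : Multiset G) = {0} := by
  simp [FS]

theorem FS_cons (a : G) (A : Multiset G) : FS (a ::ₘ A) = FS A + (FS A).map fun x ↦ x + a := by
  simp [FS, Multiset.powerset_cons, add_comm]

theorem FS_map (f : G →+ H) (A : Multiset G) : FS (A.map f) = (FS A).map f := by
  induction A using Multiset.induction with
  | empty => simp [FS_zero]
  | cons a A ih => simp [FS_cons, ih]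

/-- Two multisets are equivalent if their multisets of subset sums are translates. -/
def FSEquiv (A B : Multiset G) : Prop :=
  ∃ s : G, FS A = (FS B).map fun x ↦ x + s

namespace FSEquiv

variable {A B C D : Multiset G}

theorem refl (A : Multiset G) : FSEquiv A A :=
  ⟨0, by simp⟩

theorem symm (h : FSEquiv A B) : FSEquiv B A := by
  obtain ⟨s, hs⟩ := h
  exact ⟨-s, by simp [hs]⟩

theorem trans (h : FSEquiv A B) (h' : FSEquiv B C) : FSEquiv A C := by
  obtain ⟨s, hs⟩ := h
  obtain ⟨t, ht⟩ := h'
  exact ⟨t + s, by simp [hs, ht, add_assoc]⟩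

theorem map (f : G →+ H) (h : FSEquiv A B) : FSEquiv (A.map f) (B.map f) := by
  obtain ⟨s, hs⟩ := h
  exact ⟨f s, by simp [FS_map, hs]⟩

theorem cons (a : G) (h : FSEquiv A B) : FSEquiv (a ::ₘ A) (a ::ₘ B) := by
  obtain ⟨s, hs⟩ := h
  exact ⟨s, by simp [FS_cons, hs, add_right_comm]⟩

theorem neg_cons (a : G) (A : Multiset G) : FSEquiv (a ::ₘ A) (-a ::ₘ A) :=
  ⟨a, by simp [FS_cons, add_comm]⟩

theorem add_left (C : Multiset G) (h : FSEquiv A B) : FSEquiv (C + A) (C + B) := by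
  induction C using Multiset.induction with
  | empty => simpa using h
  | cons c C ih => simpa using ih.cons c

theorem add (h : FSEquiv A B) (h' : FSEquiv C D) : FSEquiv (A + C) (B + D) := by
  refine (h'.add_left A).trans ?_
  rw [add_comm A, add_comm B]
  exact h.add_left D

theorem of_count_add_count_neg [DecidableEq G]
    (h : ∀ g, A.count g + A.count (-g) = B.count g + B.count (-g)) : FSEquiv A B := by
  induction A using Multiset.induction generalizing B with
  | empty =>
    have : B = 0 := by
      refine Multiset.eq_zero_of_forall_notMem fun g hg ↦ ?_
      have := h g
      rw [← Multiset.count_pos] at hg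
      simp at this
      omega
    exact this ▸ refl 0
  | cons a A ih =>
    by_cases ha : a ∈ B
    · obtain ⟨B, rfl⟩ := Multiset.exists_cons_of_mem ha
      refine (ih fun g ↦ ?_).cons a
      have := h g
      simp only [Multiset.count_cons] at this
      omega
    · have ha' : -a ∈ B := by
        have := h a
        rw [Multiset.count_eq_zero_of_notMem ha, Multiset.count_cons_self] at this
        exact Multiset.count_pos.mp (by omega)
      obtain ⟨B, rfl⟩ := Multiset.exists_cons_of_mem ha'
      refine (neg_cons a A).trans ((ih fun g ↦ ?_).cons (-a))
      have := h g
      simp only [Multiset.count_cons, neg_eq_iff_eq_neg (a := g)] at this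
      have e : g = -a ↔ -g = a := neg_eq_iff_eq_neg.symm
      split_ifs at this <;> first | omega | grind

end FSEquiv

theorem sum_map_FS (χ : AddChar G ℂ) (A : Multiset G) :
    ((FS A).map χ).sum = (A.map fun a ↦ 1 + χ a).prod := by
  induction A using Multiset.induction with
  | empty => simp [FS_zero]
  | cons a A ih =>
    simp only [FS_cons, Multiset.map_add, Multiset.map_map, Function.comp_def, Multiset.sum_add,
      AddChar.map_add_eq_mul, Multiset.sum_map_mul_right, ih, Multiset.map_cons,
      Multiset.prod_cons]
    ring

theorem logNorm_count [Fintype G] [DecidableEq G] (h2 : ∀ g : G, g + g = 0 → g = 0)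
    (A : Multiset G) (χ : AddChar G ℂ) :
    logNorm (fun g ↦ (A.count g : ℝ)) χ = Real.log ‖(A.map fun a ↦ 1 + χ a).prod‖ := by
  have hne := addChar_one_add_ne_zero (odd_card_of_no_two_torsion h2) χ
  induction A using Multiset.induction with
  | empty => simp [logNorm]
  | cons a A ih =>
    have : (A.map fun a ↦ 1 + χ a).prod ≠ 0 := by
      simpa [Multiset.prod_eq_zero_iff] using fun x _ ↦ hne x
    rw [Multiset.map_cons, Multiset.prod_cons, norm_mul, Real.log_mul (by simpa using hne a)
      (by simpa using this), ← ih]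
    simp [logNorm, Multiset.count_cons, add_mul, Finset.sum_add_distrib, add_comm]

theorem logNorm_sub [Fintype G] (μ ν : G → ℝ) (χ : AddChar G ℂ) :
    logNorm (fun g ↦ μ g - ν g) χ = logNorm μ χ - logNorm ν χ := by
  simp [logNorm, sub_mul, Finset.sum_sub_distrib]

theorem logNorm_add_neg [Fintype G] (μ : G → ℝ) (χ : AddChar G ℂ) :
    logNorm (fun g ↦ μ g + μ (-g)) χ = 2 * logNorm μ χ := by
  have : ∑ g, μ (-g) * Real.log ‖1 + χ g‖ = logNorm μ χ := by
    rw [← Equiv.sum_comp (Equiv.neg G)]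
    refine Finset.sum_congr rfl fun g _ ↦ ?_
    rw [Equiv.neg_apply, neg_neg, AddChar.map_neg_eq_conj, ← Complex.norm_conj]
    simp
  simp [logNorm, add_mul, Finset.sum_add_distrib, this, two_mul]

theorem FSEquiv.logNorm_eq_zero [Fintype G] [DecidableEq G] (h2 : ∀ g : G, g + g = 0 → g = 0)
    {A B : Multiset G} (h : FSEquiv A B) (χ : AddChar G ℂ) :
    logNorm (fun g ↦ (A.count g : ℝ) - B.count g) χ = 0 := by
  obtain ⟨s, hs⟩ := h
  rw [logNorm_sub (fun g ↦ (A.count g : ℝ)), logNorm_count h2, logNorm_count h2, ← sum_map_FS,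
    ← sum_map_FS, hs]
  simp [AddChar.map_add_eq_mul, Multiset.sum_map_mul_right]

theorem FSEquiv.count_zero_eq_of_finite [Finite G] [DecidableEq G]
    (h2 : ∀ g : G, g + g = 0 → g = 0) {A B : Multiset G} (h : FSEquiv A B) :
    A.count 0 = B.count 0 := by
  have := Fintype.ofFinite G
  have h := apply_zero_eq_zero_of_kerSum
    (kerSum_eq_zero (odd_card_of_no_two_torsion h2) (h.logNorm_eq_zero h2))
  exact_mod_cast sub_eq_zero.mp h

theorem FSEquiv.count_add_self_of_finite [Finite G] [DecidableEq G]
    (h2 : ∀ g : G, g + g = 0 → g = 0) {A B : Multiset G} (h : FSEquiv A B) (g : G) :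
    (A.count g : ℤ) - B.count g + (A.count (-g) - B.count (-g)) =
      A.count (g + g) - B.count (g + g) + (A.count (-(g + g)) - B.count (-(g + g))) := by
  have := Fintype.ofFinite G
  have h := apply_add_self_eq h2 (ν := fun g ↦ ((A.count g : ℝ) - B.count g) +
    (A.count (-g) - B.count (-g))) (fun g ↦ by rw [neg_neg, add_comm]) (fun χ ↦ by
      rw [logNorm_add_neg fun g ↦ (A.count g : ℝ) - B.count g, h.logNorm_eq_zero h2, mul_zero]) g
  exact_mod_cast h.symm

end SubsetSums

section ResiduallyFinite

variable {G : Type*} [AddCommGroup G]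

theorem odd_addOrderOf (h2 : ∀ g : G, g + g = 0 → g = 0) {x : G} (hx : IsOfFinAddOrder x) :
    Odd (addOrderOf x) := by
  rw [← Nat.not_even_iff_odd]
  rintro ⟨k, hk⟩
  have h0 := hx.addOrderOf_pos
  have : addOrderOf x ∣ k :=
    addOrderOf_dvd_of_nsmul_eq_zero (h2 _ (by rw [← add_nsmul, ← hk, addOrderOf_nsmul_eq_zero]))
  have := Nat.le_of_dvd (by omega) this
  omega

theorem exists_odd_forall_nsmul_ne [AddGroup.FG G] (h2 : ∀ g : G, g + g = 0 → g = 0) {x : G}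
    (hx : x ≠ 0) : ∃ N : ℕ, Odd N ∧ ∀ y : G, N • y ≠ x := by
  by_contra! hdiv
  have : Module.Finite ℤ G := Module.Finite.iff_addGroup_fg.mpr inferInstance
  have key (m : ℕ) (hm : Odd m) : ∃ c : ℤ, (c * m) • x = x := by
    have hmem : x ∈ (⨅ i : ℕ, Ideal.span {(m : ℤ)} ^ i • ⊤ : Submodule ℤ G) := by
      rw [Submodule.mem_iInf]
      intro i
      obtain ⟨y, hy⟩ := hdiv (m ^ i) hm.pow
      rw [Ideal.span_singleton_pow, ← hy, ← natCast_zsmul, Nat.cast_pow]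
      exact Submodule.smul_mem_smul (Ideal.mem_span_singleton_self _) Submodule.mem_top
    obtain ⟨⟨r, hr⟩, hrx⟩ := (Ideal.mem_iInf_smul_pow_eq_bot_iff _ x).mp hmem
    obtain ⟨c, rfl⟩ := Ideal.mem_span_singleton'.mp hr
    exact ⟨c, hrx⟩
  by_cases hfin : IsOfFinAddOrder x
  · obtain ⟨c, hc⟩ := key _ (odd_addOrderOf h2 hfin)
    rw [mul_zsmul, natCast_zsmul, addOrderOf_nsmul_eq_zero, zsmul_zero] at hc
    exact hx hc.symm
  · obtain ⟨c, hc⟩ := key 3 (by decide)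
    have h0 : (c * (3 : ℕ) - 1) • x = 0 := by rw [sub_zsmul, hc, one_zsmul, add_neg_cancel]
    refine hfin (isOfFinAddOrder_iff_zsmul_eq_zero.mpr ⟨_, ?_, h0⟩)
    omega

theorem exists_odd_forall_mem_nsmul_ne [AddGroup.FG G] (h2 : ∀ g : G, g + g = 0 → g = 0)
    (S : Finset G) : ∃ N : ℕ, Odd N ∧ ∀ x ∈ S, ∀ y : G, N • y = x → x = 0 := by
  classical
  induction S using Finset.induction with
  | empty => exact ⟨1, odd_one, by simp⟩
  | insert a S _ ih =>
    obtain ⟨N, hN, hS⟩ := ih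
    obtain ⟨M, hM, ha⟩ : ∃ M : ℕ, Odd M ∧ ∀ y : G, M • y = a → a = 0 := by
      by_cases h : a = 0
      · exact ⟨1, odd_one, fun _ _ ↦ h⟩
      · obtain ⟨M, hM, ha⟩ := exists_odd_forall_nsmul_ne h2 h
        exact ⟨M, hM, fun y hy ↦ absurd hy (ha y)⟩
    refine ⟨N * M, hN.mul hM, fun x hx y hy ↦ ?_⟩
    rcases Finset.mem_insert.mp hx with rfl | hx
    · exact ha (N • y) (by rw [← hy, mul_nsmul])
    · exact hS x hx (M • y) (by rw [← hy, mul_nsmul'])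

theorem exists_hom_finite_injOn [AddGroup.FG G] (h2 : ∀ g : G, g + g = 0 → g = 0)
    (S : Finset G) : ∃ K : AddSubgroup G, Finite (G ⧸ K) ∧ (∀ q : G ⧸ K, q + q = 0 → q = 0) ∧
      ∀ x ∈ S, ∀ y ∈ S, (x : G ⧸ K) = y → x = y := by
  classical
  obtain ⟨N, hN, hS⟩ := exists_odd_forall_mem_nsmul_ne h2 (Finset.image₂ (fun x y ↦ -x + y) S S)
  let K : AddSubgroup G := (nsmulAddMonoidHom N : G →+ G).range
  have hq (q : G ⧸ K) : N • q = 0 := by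
    induction q using QuotientAddGroup.induction_on with
    | H g => exact (QuotientAddGroup.eq_zero_iff _).mpr ⟨g, rfl⟩
  refine ⟨K, ?_, fun q h ↦ ?_, fun x hx y hy hxy ↦ ?_⟩
  · have : AddGroup.FG (G ⧸ K) := inferInstance
    exact AddCommGroup.finite_of_fg_isAddTorsion _ fun q ↦
      isOfFinAddOrder_iff_nsmul_eq_zero.mpr ⟨N, hN.pos, hq q⟩
  · obtain ⟨k, rfl⟩ := hN
    have := hq q
    rwa [add_nsmul, mul_nsmul, two_nsmul, h, nsmul_zero, zero_add, one_nsmul] at this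
  · obtain ⟨z, hz⟩ := QuotientAddGroup.eq.mp hxy
    have := hS (-x + y) (Finset.mem_image₂_of_mem hx hy) z hz
    exact (neg_add_eq_zero.mp this)

end ResiduallyFinite

section Transfer

variable {G : Type*} [AddCommGroup G]

theorem FSEquiv.of_map_subtype {K : AddSubgroup G} {A B : Multiset K} {s : G} (hs : s ∈ K)
    (h : FS (A.map K.subtype) = (FS (B.map K.subtype)).map fun x ↦ x + s) : FSEquiv A B := by
  refine ⟨⟨s, hs⟩, Multiset.map_injective K.subtype_injective ?_⟩
  rw [← FS_map, h, FS_map]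
  simp

theorem count_map_of_injOn {K Q : Type*} [DecidableEq K] [DecidableEq Q] (f : K → Q)
    (A : Multiset K) (x : K) (h : ∀ y ∈ A, f x = f y → x = y) :
    (A.map f).count (f x) = A.count x := by
  rw [Multiset.count_map, Multiset.count_eq_card_filter_eq]
  congr 1
  exact Multiset.filter_congr fun y hy ↦ ⟨h y hy, fun h ↦ h ▸ rfl⟩

theorem FSEquiv.exists_finite [DecidableEq G] (h2 : ∀ g : G, g + g = 0 → g = 0)
    {A B : Multiset G} (h : FSEquiv A B) (F : Finset G) :
    ∃ (K : AddSubgroup G) (L : AddSubgroup K) (A' B' : Multiset (K ⧸ L)), Finite (K ⧸ L) ∧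
      (∀ q : K ⧸ L, q + q = 0 → q = 0) ∧ FSEquiv A' B' ∧ (F : Set G) ⊆ K ∧
      ∀ [DecidableEq (K ⧸ L)], ∀ g : K, (g : G) ∈ F →
        A'.count (g : K ⧸ L) = A.count (g : G) ∧ B'.count (g : K ⧸ L) = B.count (g : G) := by
  classical
  obtain ⟨s, hs⟩ := h
  let S : Finset G := insert s (F ∪ A.toFinset ∪ B.toFinset)
  let K : AddSubgroup G := AddSubgroup.closure (S : Set G)
  have hSK : (S : Set G) ⊆ K := AddSubgroup.subset_closure
  have : AddGroup.FG K := by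
    rw [AddGroup.fg_iff_addSubgroup_fg]
    exact ⟨S, rfl⟩
  have h2K (g : K) (hg : g + g = 0) : g = 0 := Subtype.ext (h2 _ (congrArg Subtype.val hg))
  obtain ⟨L, hfin, hL, hinj⟩ := exists_hom_finite_injOn h2K (S.subtype (· ∈ K))
  have hA : ∀ x ∈ A, x ∈ S := by simp +contextual [S]
  have hB : ∀ x ∈ B, x ∈ S := by simp +contextual [S]
  have hF : ∀ x ∈ F, x ∈ S := by simp +contextual [S]
  obtain ⟨A₀, hA₀⟩ : ∃ A' : Multiset K, A'.map K.subtype = A :=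
    CanLift.prf A fun x hx ↦ hSK (hA x hx)
  obtain ⟨B₀, hB₀⟩ : ∃ B' : Multiset K, B'.map K.subtype = B :=
    CanLift.prf B fun x hx ↦ hSK (hB x hx)
  rw [← hA₀, ← hB₀] at hs
  refine ⟨K, L, A₀.map (QuotientAddGroup.mk' L), B₀.map (QuotientAddGroup.mk' L), hfin, hL,
    (FSEquiv.of_map_subtype (hSK (by simp [S])) hs).map _, fun x hx ↦ hSK (hF x hx),
    fun {_} g hg ↦ ?_⟩
  have hcount (C : Multiset K) (hC : ∀ x ∈ C.map K.subtype, x ∈ S) :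
      (C.map (QuotientAddGroup.mk' L)).count (g : K ⧸ L) = (C.map K.subtype).count (g : G) := by
    refine (count_map_of_injOn _ C g fun y hy ↦ hinj _ ?_ _ ?_).trans
      (Multiset.count_map_eq_count' _ C K.subtype_injective g).symm
    · simpa using hF _ hg
    · simpa using hC _ (Multiset.mem_map_of_mem _ hy)
  constructor
  · rw [hcount A₀ (hA₀ ▸ hA), hA₀]
  · rw [hcount B₀ (hB₀ ▸ hB), hB₀]

theorem FSEquiv.count_zero_eq [DecidableEq G] (h2 : ∀ g : G, g + g = 0 → g = 0)
    {A B : Multiset G} (h : FSEquiv A B) : A.count 0 = B.count 0 := by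
  classical
  obtain ⟨K, L, A', B', hfin, hL, h', hF, hcount⟩ := h.exists_finite h2 {0}
  obtain ⟨hA, hB⟩ := hcount 0 (by simp)
  have := h'.count_zero_eq_of_finite hL
  rwa [← QuotientAddGroup.mk_zero, hA, hB] at this

theorem FSEquiv.count_add_self [DecidableEq G] (h2 : ∀ g : G, g + g = 0 → g = 0)
    {A B : Multiset G} (h : FSEquiv A B) (g : G) :
    (A.count g : ℤ) - B.count g + (A.count (-g) - B.count (-g)) =
      A.count (g + g) - B.count (g + g) + (A.count (-(g + g)) - B.count (-(g + g))) := by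
  classical
  obtain ⟨K, L, A', B', hfin, hL, h', hF, hcount⟩ :=
    h.exists_finite h2 {g, -g, g + g, -(g + g)}
  lift g to K using hF (by simp)
  obtain ⟨hA, hB⟩ := hcount g (by simp)
  obtain ⟨hA₁, hB₁⟩ := hcount (-g) (by simp)
  obtain ⟨hA₂, hB₂⟩ := hcount (g + g) (by simp)
  obtain ⟨hA₃, hB₃⟩ := hcount (-(g + g)) (by simp)
  have := h'.count_add_self_of_finite hL (g : K ⧸ L)
  simp only [← QuotientAddGroup.mk_neg, ← QuotientAddGroup.mk_add, hA, hB, hA₁, hB₁, hA₂, hB₂,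
    hA₃, hB₃] at this
  simpa using this

end Transfer

section Congruence

theorem natCast_dvd_prod_one_add_pow_sub {R : Type*} [CommRing R] {p : ℕ} (hp : p.Prime)
    (A : Multiset R) :
    (p : R) ∣ (A.map fun a ↦ 1 + a).prod ^ p - (A.map fun a ↦ 1 + a ^ p).prod := by
  induction A using Multiset.induction with
  | empty => simp
  | cons a A ih =>
    simp only [Multiset.map_cons, Multiset.prod_cons]
    obtain ⟨r, hr⟩ := exists_add_pow_prime_eq hp 1 a
    obtain ⟨t, ht⟩ := ih
    rw [sub_eq_iff_eq_add] at ht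
    refine ⟨a * r * (A.map fun a ↦ 1 + a).prod ^ p + (1 + a ^ p) * t, ?_⟩
    rw [mul_pow, hr, ht]
    ring

theorem prod_one_add_dvd_two_pow {R : Type*} [CommRing R] {n : ℕ} (hn : Odd n)
    (A : Multiset R) (hA : ∀ a ∈ A, a ^ n = 1) :
    (A.map fun a ↦ 1 + a).prod ∣ 2 ^ A.card := by
  induction A using Multiset.induction with
  | empty => simp
  | cons a A ih =>
    rw [Multiset.map_cons, Multiset.prod_cons, Multiset.card_cons, pow_succ']
    refine mul_dvd_mul ?_ (ih fun x hx ↦ hA x (Multiset.mem_cons_of_mem hx))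
    have := hn.add_dvd_pow_add_pow 1 a
    rwa [hA a (Multiset.mem_cons_self a A), one_pow, one_add_one_eq_two] at this

theorem natCast_dvd_two_pow_of_prod_one_add_eq {R : Type*} [CommRing R] {p n : ℕ}
    (hp : p.Prime) (hp2 : Odd p) (hn : Odd n) {A B : Multiset R} {c : R} (hc : c ^ n = 1)
    (hB : ∀ b ∈ B, b ^ n = 1)
    (h : (A.map fun a ↦ 1 + a).prod = -(c * (B.map fun b ↦ 1 + b).prod))
    (h' : (A.map fun a ↦ 1 + a ^ p).prod = c ^ p * (B.map fun b ↦ 1 + b ^ p).prod) :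
    (p : R) ∣ 2 ^ (B.card + 1) := by
  have hdA := natCast_dvd_prod_one_add_pow_sub hp A
  have hdB := natCast_dvd_prod_one_add_pow_sub hp B
  rw [h, h', hp2.neg_pow, mul_pow] at hdA
  have h1 : (p : R) ∣ c ^ p * ((B.map fun b ↦ 1 + b ^ p).prod * 2) := by
    have := (dvd_neg.mpr hdA).sub (hdB.mul_left (c ^ p))
    convert this using 1
    ring
  have hc' : IsUnit (c ^ p) := (IsUnit.of_pow_eq_one hc hn.pos.ne').pow p
  have h2 : (B.map fun b ↦ 1 + b ^ p).prod ∣ 2 ^ B.card := by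
    have := prod_one_add_dvd_two_pow hn (B.map fun b ↦ b ^ p) (by
      simp only [Multiset.mem_map, forall_exists_index, and_imp]
      rintro _ b hb rfl
      rw [pow_right_comm, hB b hb, one_pow])
    simpa using this
  rw [pow_succ]
  exact ((hc'.dvd_mul_left).mp h1).trans (mul_dvd_mul_right h2 2)

theorem dvd_of_natCast_dvd_integralClosure {p m : ℕ} (hp : p ≠ 0)
    (h : (p : integralClosure ℤ ℂ) ∣ (m : integralClosure ℤ ℂ)) : p ∣ m := by
  obtain ⟨r, hr⟩ := h
  have hr' : (m : ℂ) = p * (r : ℂ) := by exact_mod_cast congrArg Subtype.val hr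
  have hq : (r : ℂ) = algebraMap ℚ ℂ (m / p) := by
    have : (p : ℂ) ≠ 0 := by exact_mod_cast hp
    simp [hr', this]
  have hint : IsIntegral ℤ (m / p : ℚ) := by
    rw [← isIntegral_algebraMap_iff (algebraMap ℚ ℂ).injective, ← hq]
    exact r.2
  obtain ⟨k, hk⟩ := IsIntegrallyClosed.isIntegral_iff.mp hint
  have hp' : (p : ℚ) ≠ 0 := by exact_mod_cast hp
  rw [eq_div_iff hp'] at hk
  have : (k * p : ℤ) = m := by
    simp only [algebraMap_int_eq, eq_intCast] at hk
    exact_mod_cast hk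
  exact Int.natCast_dvd_natCast.mp ⟨k, by rw [← this, mul_comm]⟩

end Congruence

section FiniteConverse

variable {G : Type*} [AddCommGroup G]

theorem prod_one_add_sq [Finite G] (χ : AddChar G ℂ) (A : Multiset G) :
    (A.map fun a ↦ 1 + χ a).prod ^ 2 =
      χ A.sum * (‖(A.map fun a ↦ 1 + χ a).prod‖ : ℂ) ^ 2 := by
  induction A using Multiset.induction with
  | empty => simp
  | cons a A ih =>
    have h1 : χ a * starRingEnd ℂ (χ a) = 1 := by
      rw [Complex.mul_conj']
      simp
    have h : (1 + χ a) ^ 2 = χ a * (‖1 + χ a‖ : ℂ) ^ 2 := by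
      rw [← Complex.mul_conj', map_add, map_one]
      linear_combination (-(1 + χ a)) * h1
    simp only [Multiset.map_cons, Multiset.prod_cons, Multiset.sum_cons, mul_pow, norm_mul, ih, h,
      AddChar.map_add_eq_mul, Complex.ofReal_mul]
    ring

theorem prod_one_add_eq_of_pow_prime [Finite G] (hodd : Odd (Nat.card G)) {A B : Multiset G}
    {s : G} {χ : AddChar G ℂ} {p : ℕ} (hp : p.Prime) (hp2 : Odd p)
    (hχ : (A.map fun a ↦ 1 + (χ ^ p) a).prod = (χ ^ p) s * (B.map fun b ↦ 1 + (χ ^ p) b).prod) :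
    (A.map fun a ↦ 1 + χ a).prod ≠ -(χ s * (B.map fun b ↦ 1 + χ b).prod) := by
  intro h
  have hint (g : G) : IsIntegral ℤ (χ g) :=
    IsIntegral.of_pow Nat.card_pos (by rw [addChar_apply_pow_card]; exact isIntegral_one)
  let ρ (g : G) : integralClosure ℤ ℂ := ⟨χ g, hint g⟩
  have hρ (g : G) : ρ g ^ Nat.card G = 1 := Subtype.ext (addChar_apply_pow_card χ g)
  have hprod (C : Multiset G) (k : ℕ) :
      ((((C.map ρ).map fun a ↦ 1 + a ^ k).prod : integralClosure ℤ ℂ) : ℂ) =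
        (C.map fun a ↦ 1 + χ a ^ k).prod := by
    induction C using Multiset.induction with
    | empty => simp
    | cons a C ih =>
      simp only [Multiset.map_cons, Multiset.prod_cons, MulMemClass.coe_mul, ih]
      rfl
  have h1 := natCast_dvd_two_pow_of_prod_one_add_eq hp hp2 hodd (A := A.map ρ) (B := B.map ρ)
    (hρ s) (by simpa using fun b _ ↦ hρ b) (Subtype.ext (by
      have hA := hprod A 1
      have hB := hprod B 1
      simp only [pow_one] at hA hB
      simpa only [NegMemClass.coe_neg, MulMemClass.coe_mul, hA, hB] using h)) (Subtype.ext (by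
      simpa only [MulMemClass.coe_mul, hprod, SubmonoidClass.coe_pow, AddChar.pow_apply] using hχ))
  have h2 : p ∣ 2 ^ ((B.map ρ).card + 1) :=
    dvd_of_natCast_dvd_integralClosure hp.ne_zero (by exact_mod_cast h1)
  have h3 := (Nat.prime_dvd_prime_iff_eq hp Nat.prime_two).mp (hp.dvd_of_dvd_pow h2)
  rw [h3] at hp2
  exact absurd hp2 (by decide)

theorem prod_one_add_eq_of_pow_odd [Finite G] (hodd : Odd (Nat.card G)) {A B : Multiset G} {s : G}
    (hsign : ∀ χ : AddChar G ℂ,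
      (A.map fun a ↦ 1 + χ a).prod = χ s * (B.map fun b ↦ 1 + χ b).prod ∨
        (A.map fun a ↦ 1 + χ a).prod = -(χ s * (B.map fun b ↦ 1 + χ b).prod))
    {n : ℕ} (hn : Odd n) {χ : AddChar G ℂ}
    (hχ : (A.map fun a ↦ 1 + (χ ^ n) a).prod = (χ ^ n) s * (B.map fun b ↦ 1 + (χ ^ n) b).prod) :
    (A.map fun a ↦ 1 + χ a).prod = χ s * (B.map fun b ↦ 1 + χ b).prod := by
  induction n using induction_on_primes generalizing χ with
  | zero => simp at hn
  | one => simpa using hχ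
  | prime_mul p n hp ih =>
    obtain ⟨hpo, hno⟩ := Nat.odd_mul.mp hn
    rw [pow_mul] at hχ
    exact (hsign χ).resolve_right (prod_one_add_eq_of_pow_prime hodd hp hpo (ih hno hχ))

theorem sum_count_mul {α : Type*} [Fintype α] [DecidableEq α] (f : α → ℂ) (M : Multiset α) :
    ∑ g, (M.count g : ℂ) * f g = (M.map f).sum := by
  induction M using Multiset.induction with
  | empty => simp
  | cons a M ih => simp [Multiset.count_cons, add_mul, Finset.sum_add_distrib, ih, add_comm]

theorem kerSum_count [Fintype G] [DecidableEq G] (A : Multiset G) (χ : AddChar G ℂ)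
    [DecidablePred (χ · = 1)] :
    kerSum (fun g ↦ (A.count g : ℝ)) χ = A.countP (χ · = 1) := by
  rw [Multiset.countP_eq_card_filter, ← Multiset.sum_count_eq_card (s := Finset.univ) (by simp)]
  push_cast
  refine Finset.sum_congr rfl fun g _ ↦ ?_
  rw [Multiset.count_filter]
  split_ifs <;> simp

theorem logNorm_eq_zero_of_apply_add_self [Fintype G] (h2 : ∀ g : G, g + g = 0 → g = 0)
    {ν : G → ℝ} (hν : ∀ g, ν (g + g) = ν g) {χ : AddChar G ℂ} (hχ : kerSum ν χ = 0) :
    logNorm ν χ = 0 := by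
  have hinj := add_self_injective h2
  have hsq (χ : AddChar G ℂ) : logNorm ν (χ ^ 2) = logNorm ν χ := by
    refine Fintype.sum_bijective _ (Finite.injective_iff_bijective.mp hinj) _ _ fun g ↦ ?_
    rw [hν, AddChar.map_add_eq_mul, AddChar.pow_apply, sq]
  have hpow (k : ℕ) : logNorm ν (χ ^ 2 ^ k) = logNorm ν χ := by
    induction k with
    | zero => simp
    | succ k ih => rw [pow_succ, pow_mul, hsq, ih]
  have h := sum_logNorm_pow_two_pow (odd_card_of_no_two_torsion h2) ν χ
  simp only [hpow, hχ, mul_zero, Finset.sum_const, Finset.card_range, nsmul_eq_mul,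
    mul_eq_zero, Nat.cast_eq_zero] at h
  exact h.resolve_left (Nat.totient_pos.mpr Nat.card_pos).ne'

theorem exists_add_self_eq [Finite G] (h2 : ∀ g : G, g + g = 0 → g = 0) (g : G) :
    ∃ s, s + s = g :=
  Finite.surjective_of_injective (add_self_injective h2) g

theorem FSEquiv.of_prod_one_add [Finite G] {A B : Multiset G} {s : G}
    (h : ∀ χ : AddChar G ℂ,
      (A.map fun a ↦ 1 + χ a).prod = χ s * (B.map fun b ↦ 1 + χ b).prod) : FSEquiv A B := by
  classical
  have := Fintype.ofFinite G
  refine ⟨s, Multiset.ext.mpr fun g ↦ ?_⟩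
  have key := eq_of_forall_sum_mul_addChar_eq (G := G) (μ := fun g ↦ ((FS A).count g : ℂ))
    (ν := fun g ↦ (((FS B).map fun x ↦ x + s).count g : ℂ)) fun χ ↦ by
      rw [sum_count_mul, sum_count_mul, sum_map_FS, h]
      simp only [Multiset.map_map, Function.comp_def, AddChar.map_add_eq_mul,
        Multiset.sum_map_mul_right, sum_map_FS]
      rw [mul_comm]
  exact_mod_cast congrFun key g

theorem FSEquiv.of_finite [Finite G] [DecidableEq G]
    (h2 : ∀ g : G, g + g = 0 → g = 0) {A B : Multiset G}
    (hd : ∀ g, (A.count g : ℤ) - B.count g + (A.count (-g) - B.count (-g)) =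
      A.count (g + g) - B.count (g + g) + (A.count (-(g + g)) - B.count (-(g + g))))
    (hH : ∀ (H : AddSubgroup G) [DecidablePred (· ∈ H)], A.countP (· ∈ H) = B.countP (· ∈ H)) :
    FSEquiv A B := by
  classical
  have := Fintype.ofFinite G
  have hodd := odd_card_of_no_two_torsion h2
  let μ : G → ℝ := fun g ↦ (A.count g : ℝ) - B.count g
  have hker (χ : AddChar G ℂ) : kerSum μ χ = 0 := by
    let H : AddSubgroup G :=
      { carrier := {g | χ g = 1}
        zero_mem' := χ.map_zero_eq_one
        add_mem' := fun {a b} (ha : χ a = 1) (hb : χ b = 1) ↦ by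
          simp [AddChar.map_add_eq_mul, ha, hb]
        neg_mem' := fun {a} (ha : χ a = 1) ↦ by simp [AddChar.map_neg_eq_inv, ha] }
    have h1 : A.countP (χ · = 1) = B.countP (χ · = 1) := hH H
    have h3 : kerSum μ χ = kerSum (fun g ↦ (A.count g : ℝ)) χ -
        kerSum (fun g ↦ (B.count g : ℝ)) χ := by
      simp only [kerSum, ← Finset.sum_sub_distrib, μ]
      exact Finset.sum_congr rfl fun g _ ↦ by split_ifs <;> ring
    rw [h3, kerSum_count, kerSum_count, h1, sub_self]
  have hkerneg (χ : AddChar G ℂ) : kerSum (fun g ↦ μ g + μ (-g)) χ = 0 := by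
    have h3 : ∑ g, (if χ g = 1 then μ (-g) else 0) = kerSum μ χ := by
      rw [← Equiv.sum_comp (Equiv.neg G)]
      simp [kerSum, AddChar.map_neg_eq_inv]
    have h4 : kerSum (fun g ↦ μ g + μ (-g)) χ =
        kerSum μ χ + ∑ g, (if χ g = 1 then μ (-g) else 0) := by
      simp only [kerSum, ← Finset.sum_add_distrib]
      exact Finset.sum_congr rfl fun g _ ↦ by split_ifs <;> ring
    rw [h4, h3, hker, add_zero]
  have hlog (χ : AddChar G ℂ) : logNorm μ χ = 0 := by
    have h3 := logNorm_eq_zero_of_apply_add_self h2 (ν := fun g ↦ μ g + μ (-g))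
      (fun g ↦ by simp only [μ]; exact_mod_cast (hd g).symm) (hkerneg χ)
    rw [logNorm_add_neg] at h3
    linarith
  have hne (C : Multiset G) (χ : AddChar G ℂ) : (C.map fun a ↦ 1 + χ a).prod ≠ 0 := by
    simpa [Multiset.prod_eq_zero_iff] using fun x _ ↦ addChar_one_add_ne_zero hodd χ x
  have hnorm (χ : AddChar G ℂ) :
      ‖(A.map fun a ↦ 1 + χ a).prod‖ = ‖(B.map fun b ↦ 1 + χ b).prod‖ := by
    refine Real.log_injOn_pos (norm_pos_iff.mpr (hne A χ)) (norm_pos_iff.mpr (hne B χ)) ?_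
    rw [← logNorm_count h2, ← logNorm_count h2, ← sub_eq_zero, ← logNorm_sub]
    exact hlog χ
  obtain ⟨s, hs⟩ := exists_add_self_eq h2 (A.sum - B.sum)
  refine .of_prod_one_add (s := s) fun χ ↦ ?_
  refine prod_one_add_eq_of_pow_odd hodd (fun χ ↦ sq_eq_sq_iff_eq_or_eq_neg.mp ?_) hodd ?_
  · rw [mul_pow, prod_one_add_sq, prod_one_add_sq, hnorm, ← mul_assoc, sq (χ s),
      ← AddChar.map_add_eq_mul, hs, ← AddChar.map_add_eq_mul, sub_add_cancel]
  · have hcard : A.card = B.card := by simpa using hH ⊤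
    rw [addChar_pow_card]
    simp [hcard]

end FiniteConverse

section General

variable {G : Type*} [AddCommGroup G]

theorem memV.apply_add_apply_neg_eq_zero {μ : G → ℤ} (hfin : (Function.support μ).Finite)
    (hd : ∀ g : G, μ g + μ (-g) = μ (g + g) + μ (-(g + g))) {g : G} (hg : ¬IsOfFinAddOrder g) :
    μ g + μ (-g) = 0 := by
  by_contra hne
  have hpow (k : ℕ) : μ (2 ^ k • g) + μ (-(2 ^ k • g)) = μ g + μ (-g) := by
    induction k with
    | zero => simp
    | succ k ih => rw [pow_succ, mul_nsmul', two_nsmul, nsmul_add, ← hd, ih]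
  have hinj : Function.Injective fun k : ℕ ↦ 2 ^ k • g := fun a b hab ↦
    Nat.pow_right_injective le_rfl (injective_nsmul_iff_not_isOfFinAddOrder.mpr hg hab)
  refine Set.infinite_range_of_injective hinj
    ((hfin.union (hfin.preimage neg_injective.injOn)).subset ?_)
  rintro _ ⟨k, rfl⟩
  by_contra h
  simp only [Set.mem_union, Set.mem_preimage, Function.mem_support, not_or, not_not] at h
  exact hne (by rw [← hpow k, h.1, h.2, add_zero])

theorem finite_support_count_sub_count {α : Type*} [DecidableEq α] (A B : Multiset α) :
    (Function.support fun g ↦ (A.count g : ℤ) - B.count g).Finite := by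
  refine (A.toFinset ∪ B.toFinset).finite_toSet.subset fun g hg ↦ ?_
  by_contra h
  simp only [Finset.coe_union, Set.mem_union, Finset.mem_coe, Multiset.mem_toFinset,
    not_or] at h
  exact hg (by simp [Multiset.count_eq_zero_of_notMem h.1, Multiset.count_eq_zero_of_notMem h.2])

theorem finsum_mem_count_sub_count {α : Type*} [DecidableEq α] (A B : Multiset α) (S : Set α)
    [DecidablePred (· ∈ S)] :
    ∑ᶠ g ∈ S, ((A.count g : ℤ) - B.count g) = A.countP (· ∈ S) - B.countP (· ∈ S) := by
  let F : Finset α := {g ∈ A.toFinset ∪ B.toFinset | g ∈ S}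
  have key (C : Multiset α) (hC : ∀ g ∈ C, g ∈ A.toFinset ∪ B.toFinset) :
      ∑ g ∈ F, (C.count g : ℤ) = C.countP (· ∈ S) := by
    rw [Multiset.countP_eq_card_filter, ← Multiset.sum_count_eq_card (s := F)
      fun g hg ↦ Finset.mem_filter.mpr ⟨hC g (Multiset.mem_of_mem_filter hg),
        Multiset.of_mem_filter hg⟩]
    push_cast
    refine Finset.sum_congr rfl fun g hg ↦ ?_
    rw [Multiset.count_filter_of_pos (Finset.mem_filter.mp hg).2]
  rw [finsum_mem_eq_sum_of_inter_support_eq _ (t := F), Finset.sum_sub_distrib,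
    key A (by simp +contextual), key B (by simp +contextual)]
  ext g
  simp only [F, Set.mem_inter_iff, Function.mem_support, Finset.mem_coe, Finset.mem_filter,
    Finset.mem_union, Multiset.mem_toFinset]
  by_cases hA : g ∈ A <;> by_cases hB : g ∈ B <;> simp [hA, hB]

theorem memV_count_sub_count_iff [DecidableEq G] {A B : Multiset G} :
    memV (fun g ↦ (A.count g : ℤ) - B.count g) ↔
      (∀ g, (A.count g : ℤ) - B.count g + (A.count (-g) - B.count (-g)) =
        A.count (g + g) - B.count (g + g) + (A.count (-(g + g)) - B.count (-(g + g)))) ∧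
      ∀ (H : AddSubgroup G) [DecidablePred (· ∈ H)],
        A.countP (· ∈ H) = B.countP (· ∈ H) := by
  classical
  have hs (H : AddSubgroup G) (h : DecidablePred (· ∈ H)) :
      ∑ᶠ g ∈ (H : Set G), ((A.count g : ℤ) - B.count g) = A.countP (· ∈ H) - B.countP (· ∈ H) :=
    @finsum_mem_count_sub_count _ _ A B H h
  refine ⟨fun h ↦ ⟨h.2.1, fun H hdec ↦ ?_⟩, fun h ↦
    ⟨finite_support_count_sub_count A B, h.1, fun H ↦ ?_⟩⟩
  · have := (hs H hdec).symm.trans (h.2.2 H)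
    exact_mod_cast sub_eq_zero.mp this
  · have := hs H (Classical.decPred _)
    rw [this, h.2, sub_self]

theorem FSEquiv.memV [DecidableEq G] (h2 : ∀ g : G, g + g = 0 → g = 0)
    {A B : Multiset G} (h : FSEquiv A B) : memV (fun g ↦ (A.count g : ℤ) - B.count g) := by
  classical
  have hd := h.count_add_self h2
  have hfin := finite_support_count_sub_count A B
  refine ⟨hfin, hd, fun H ↦ ?_⟩
  let T : AddSubgroup G := H ⊓ AddCommGroup.torsion G
  have hT (g : G) : g ∈ T ↔ g ∈ H ∧ IsOfFinAddOrder g := Iff.rfl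
  rw [← finsum_mem_inter_add_sdiff' (T : Set G) (hfin.subset Set.inter_subset_right),
    Set.inter_eq_right.mpr (show (T : Set G) ⊆ H from fun g hg ↦ hg.1)]
  have htors : ∑ᶠ g ∈ (T : Set G), ((A.count g : ℤ) - B.count g) = 0 := by
    have h2T (q : G ⧸ T) (hq : q + q = 0) : q = 0 := by
      induction q using QuotientAddGroup.induction_on with
      | H g =>
        have hg : g + g ∈ T := (QuotientAddGroup.eq_zero_iff _).mp hq
        have hfg : IsOfFinAddOrder g := by
          have := ((hT _).mp hg).2
          rw [← two_nsmul] at this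
          exact (isOfFinAddOrder_nsmul.mp this).resolve_right two_ne_zero
        obtain ⟨k, hk⟩ := odd_addOrderOf h2 hfg
        have h0 := addOrderOf_nsmul_eq_zero g
        rw [hk, add_nsmul, one_nsmul, mul_comm, mul_nsmul', two_nsmul] at h0
        rw [QuotientAddGroup.eq_zero_iff, ← neg_mem_iff, ← eq_neg_of_add_eq_zero_left h0]
        exact T.nsmul_mem hg k
    have hc := (h.map (QuotientAddGroup.mk' T)).count_zero_eq h2T
    rw [finsum_mem_count_sub_count, sub_eq_zero]
    rw [Multiset.count_map, Multiset.count_map,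
      ← Multiset.countP_eq_card_filter, ← Multiset.countP_eq_card_filter] at hc
    simp only [eq_comm (a := (0 : G ⧸ T)), QuotientAddGroup.mk'_apply,
      QuotientAddGroup.eq_zero_iff] at hc
    exact_mod_cast hc
  rw [htors, zero_add]
  have hinf : ∑ᶠ g ∈ (H \ T : Set G), ((A.count g : ℤ) - B.count g) =
      ∑ᶠ g ∈ (H \ T : Set G), -((A.count g : ℤ) - B.count g) := by
    have hmaps : Set.MapsTo Neg.neg (H \ T : Set G) (H \ T) := fun g hg ↦
      ⟨neg_mem hg.1, fun h' ↦ hg.2 (neg_mem_iff.mp h')⟩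
    refine finsum_mem_eq_of_bijOn Neg.neg ⟨hmaps, neg_injective.injOn, fun g hg ↦
      ⟨-g, hmaps hg, neg_neg g⟩⟩ fun g hg ↦ ?_
    refine eq_neg_of_add_eq_zero_left (memV.apply_add_apply_neg_eq_zero hfin hd fun hg' ↦ ?_)
    exact hg.2 ((hT g).mpr ⟨hg.1, hg'⟩)
  have hneg := (negAddMonoidHom : ℤ →+ ℤ).map_finsum_mem' (s := (H \ T : Set G))
    (f := fun g ↦ (A.count g : ℤ) - B.count g) (hfin.subset Set.inter_subset_right)
  simp only [negAddMonoidHom_apply] at hneg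
  rw [← hneg] at hinf
  change ∑ᶠ g ∈ (H \ T : Set G), ((A.count g : ℤ) - B.count g) = 0
  omega

theorem FSEquiv.of_isOfFinAddOrder [DecidableEq G] (h2 : ∀ g : G, g + g = 0 → g = 0)
    {A B : Multiset G} (hA : ∀ a ∈ A, IsOfFinAddOrder a) (hB : ∀ b ∈ B, IsOfFinAddOrder b)
    (hd : ∀ g, (A.count g : ℤ) - B.count g + (A.count (-g) - B.count (-g)) =
      A.count (g + g) - B.count (g + g) + (A.count (-(g + g)) - B.count (-(g + g))))
    (hH : ∀ (H : AddSubgroup G) [DecidablePred (· ∈ H)], A.countP (· ∈ H) = B.countP (· ∈ H)) :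
    FSEquiv A B := by
  classical
  let S : Finset G := A.toFinset ∪ B.toFinset
  let K : AddSubgroup G := AddSubgroup.closure (S : Set G)
  have hSK : (S : Set G) ⊆ K := AddSubgroup.subset_closure
  have hKT : K ≤ AddCommGroup.torsion G := by
    rw [AddSubgroup.closure_le]
    intro g hg
    simp only [S, Finset.coe_union, Set.mem_union, Finset.mem_coe, Multiset.mem_toFinset] at hg
    exact hg.elim (hA g) (hB g)
  have : AddGroup.FG K := by
    rw [AddGroup.fg_iff_addSubgroup_fg]
    exact ⟨S, rfl⟩
  have : Finite K := AddCommGroup.finite_of_fg_isAddTorsion _ fun q ↦ by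
    have : IsOfFinAddOrder (q : G) := hKT q.2
    exact AddSubmonoid.isOfFinAddOrder_coe.mp this
  obtain ⟨A₀, hA₀⟩ : ∃ A' : Multiset K, A'.map K.subtype = A :=
    CanLift.prf A fun x hx ↦ hSK (by simp [S, hx])
  obtain ⟨B₀, hB₀⟩ : ∃ B' : Multiset K, B'.map K.subtype = B :=
    CanLift.prf B fun x hx ↦ hSK (by simp [S, hx])
  rw [← hA₀, ← hB₀] at hd hH ⊢
  refine (FSEquiv.of_finite (fun g hg ↦ Subtype.ext (h2 _ (congrArg Subtype.val hg)))
    (fun g ↦ ?_) fun H _ ↦ ?_).map K.subtype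
  · have hc (C : Multiset K) (x : K) : (C.map K.subtype).count (x : G) = C.count x :=
      Multiset.count_map_eq_count' _ C K.subtype_injective x
    have := hd g
    simpa only [← AddSubgroup.coe_neg, ← AddSubgroup.coe_add, hc] using this
  · have := hH (H.map K.subtype)
    simpa [Multiset.countP_map, ← Multiset.countP_eq_card_filter] using this

theorem memV.fsEquiv [DecidableEq G] (h2 : ∀ g : G, g + g = 0 → g = 0)
    {A B : Multiset G} (h : _root_.memV fun g ↦ (A.count g : ℤ) - B.count g) : FSEquiv A B := by
  classical
  have hfin := h.1
  obtain ⟨hd, hH⟩ := memV_count_sub_count_iff.mp h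
  rw [← Multiset.filter_add_not IsOfFinAddOrder A, ← Multiset.filter_add_not IsOfFinAddOrder B]
  refine .add (.of_isOfFinAddOrder h2 (by simp) (by simp) (fun g ↦ ?_) fun H _ ↦ ?_)
    (.of_count_add_count_neg fun g ↦ ?_)
  · have : IsOfFinAddOrder (g + g) ↔ IsOfFinAddOrder g := by
      rw [← two_nsmul, isOfFinAddOrder_nsmul, or_iff_left two_ne_zero]
    simp only [Multiset.count_filter, isOfFinAddOrder_neg_iff, this]
    split_ifs
    · exact hd g
    · simp
  · have := hH (H ⊓ AddCommGroup.torsion G)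
    have hT (g : G) : g ∈ AddCommGroup.torsion G ↔ IsOfFinAddOrder g := Iff.rfl
    simpa [Multiset.countP_filter, hT] using this
  · simp only [Multiset.count_filter, isOfFinAddOrder_neg_iff]
    split_ifs with hg
    · rfl
    · have := memV.apply_add_apply_neg_eq_zero hfin hd hg
      omega

end General

theorem stmt0 {G : Type*} [AddCommGroup G] [DecidableEq G]
    (h2 : ∀ g : G, g + g = 0 → g = 0) (A B : Multiset G) :
    (∃ s : G, FS A = (FS B).map (fun x => x + s)) ↔
      memV (fun g => (A.count g : ℤ) - (B.count g : ℤ)) :=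
  ⟨fun h ↦ FSEquiv.memV h2 h, memV.fsEquiv h2⟩
end

section
/- Let G be an abelian torsion group with no elements of order 2. For each finite cyclic subgroup H ≤ G, let H^× denote the set of generators of H, and let Ṽ(H) be the group of functions μ : H^× → ℤ satisfying μ(g)+μ(−g)=μ(2g)+μ(−2g) for all g ∈ H^× and Σ_{g∈H^×} μ(g)=0. Then the map μ ↦ (μ|_{H^×})_{H ≤ G cyclic} defines a ℤ-module isomorphism from V(G) onto the direct sum ⊕_{H ≤ G cyclic} Ṽ(H). -/
open scoped BigOperators

/-- The set `H^×` of generators of a cyclic subgroup `H` of `G`. -/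
def gens {G : Type*} [AddCommGroup G] (H : AddSubgroup G) : Set G :=
  {g : G | AddSubgroup.zmultiples g = H}

/-- `Ṽ(H)`: functions on `H^×` (encoded as functions on `G` vanishing off `H^×`)
satisfying the two defining conditions. -/
def memTildeV {G : Type*} [AddCommGroup G] (H : AddSubgroup G) (ν : G → ℤ) : Prop :=
  (∀ g ∉ gens H, ν g = 0) ∧
  (∀ g ∈ gens H, ν g + ν (-g) = ν (g + g) + ν (-(g + g))) ∧
  ∑ᶠ g ∈ gens H, ν g = 0

theorem mem_gens {G : Type*} [AddCommGroup G] {H : AddSubgroup G} {g : G} :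
    g ∈ gens H ↔ AddSubgroup.zmultiples g = H := Iff.rfl

theorem gens_subset {G : Type*} [AddCommGroup G] (H : AddSubgroup G) : gens H ⊆ (H : Set G) := by
  rintro g rfl
  exact AddSubgroup.mem_zmultiples g

/-- Doubling does not change the cyclic subgroup generated by an element of finite order,
provided that there is no 2-torsion. -/
theorem zmultiples_add_self {G : Type*} [AddCommGroup G]
    (h2 : ∀ g : G, g + g = 0 → g = 0) {g : G} (hg : IsOfFinAddOrder g) :
    AddSubgroup.zmultiples (g + g) = AddSubgroup.zmultiples g := by
  apply le_antisymm
  · rw [AddSubgroup.zmultiples_le]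
    exact add_mem (AddSubgroup.mem_zmultiples g) (AddSubgroup.mem_zmultiples g)
  · rw [AddSubgroup.zmultiples_le]
    have hpos := hg.addOrderOf_pos
    have hn := addOrderOf_nsmul_eq_zero g
    rcases Nat.even_or_odd' (addOrderOf g) with ⟨k, hk | hk⟩
    · have hk0 : k • g = 0 := h2 _ (by rw [← add_nsmul, ← two_mul, ← hk, hn])
      have := Nat.le_of_dvd (by omega) (addOrderOf_dvd_of_nsmul_eq_zero hk0)
      omega
    · have h : g = -(k • (g + g)) := by
        rw [hk, add_nsmul, one_nsmul, mul_comm, mul_nsmul, two_nsmul, ← nsmul_add] at hn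
        exact eq_neg_of_add_eq_zero_right hn
      have hmem : -(k • (g + g)) ∈ AddSubgroup.zmultiples (g + g) :=
        neg_mem (nsmul_mem (AddSubgroup.mem_zmultiples _) k)
      rwa [← h] at hmem

/-- A finitely supported function that sums to zero over the generators of each cyclic subgroup
of `H` sums to zero over `H`. -/
theorem finsum_mem_subgroup_eq_zero {G : Type*} [AddCommGroup G] {μ : G → ℤ}
    (hμ : (Function.support μ).Finite) (H : AddSubgroup G)
    (h : ∀ g ∈ H, ∑ᶠ x ∈ gens (AddSubgroup.zmultiples g), μ x = 0) :
    ∑ᶠ g ∈ (H : Set G), μ g = 0 := by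
  classical
  rw [finsum_mem_eq_sum_filter _ _ hμ, ← Finset.sum_fiberwise_of_maps_to
    (g := AddSubgroup.zmultiples) (fun _ => Finset.mem_image_of_mem _)]
  refine Finset.sum_eq_zero fun K hK => ?_
  obtain ⟨g, hg, rfl⟩ := Finset.mem_image.mp hK
  have hgH : g ∈ H := (Finset.mem_filter.mp hg).2
  rw [← h g hgH, finsum_mem_eq_sum_filter _ _ hμ, Finset.filter_filter]
  refine Finset.sum_congr (Finset.filter_congr fun x _ => ?_) fun _ _ => rfl
  refine ⟨fun hx => hx.2, fun hx => ⟨?_, hx⟩⟩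
  exact (AddSubgroup.zmultiples_le.mpr hgH) (gens_subset _ hx)

/-- Möbius inversion over cyclic subgroups: a finitely supported function that sums to zero over
every subgroup also sums to zero over the generators of every cyclic subgroup. -/
theorem finsum_mem_gens_eq_zero {G : Type*} [AddCommGroup G]
    (htor : ∀ g : G, IsOfFinAddOrder g) {μ : G → ℤ} (hμ : (Function.support μ).Finite)
    (h : ∀ H : AddSubgroup G, ∑ᶠ g ∈ (H : Set G), μ g = 0) (g : G) :
    ∑ᶠ x ∈ gens (AddSubgroup.zmultiples g), μ x = 0 := by
  induction hn : addOrderOf g using Nat.strong_induction_on generalizing g with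
  | _ n ih =>
    subst hn
    set K := AddSubgroup.zmultiples g with hK
    have hfin : (Function.support ((gens K)ᶜ.indicator μ)).Finite :=
      hμ.subset (by rw [Set.support_indicator]; exact Set.inter_subset_right)
    have hrest : ∑ᶠ x ∈ (K : Set G), (gens K)ᶜ.indicator μ x = 0 := by
      refine finsum_mem_subgroup_eq_zero hfin K fun y hy => ?_
      by_cases hyK : AddSubgroup.zmultiples y = K
      · refine finsum_mem_eq_zero_of_forall_eq_zero fun x hx => ?_
        rw [hyK] at hx
        exact Set.indicator_of_notMem (Set.notMem_compl_iff.mpr hx) _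
      · have hle : AddSubgroup.zmultiples y ≤ K := AddSubgroup.zmultiples_le.mpr hy
        have hKfin : (K : Set G).Finite := finite_zmultiples.mpr (htor g)
        have hlt : addOrderOf y < addOrderOf g := by
          rw [← Nat.card_zmultiples, ← Nat.card_zmultiples]
          exact Set.ncard_lt_ncard (SetLike.coe_ssubset_coe.mpr (lt_of_le_of_ne hle hyK)) hKfin
        rw [← ih _ hlt y rfl]
        refine finsum_mem_congr rfl fun x hx => Set.indicator_of_mem ?_ _
        exact Set.mem_compl fun hx' => hyK ((mem_gens.mp hx).symm.trans (mem_gens.mp hx'))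
    have hsplit := finsum_mem_inter_add_sdiff' (gens K) (s := (K : Set G))
      (hμ.subset Set.inter_subset_right)
    rw [h K, Set.inter_eq_right.mpr (gens_subset K)] at hsplit
    have hsdiff : ∑ᶠ x ∈ (K : Set G) \ gens K, μ x = 0 := by
      rw [← hrest, finsum_mem_def, finsum_mem_def, Set.indicator_indicator, Set.sdiff_eq]
    rwa [hsdiff, add_zero] at hsplit

/-- The map `μ ↦ (μ|_{H^×})_{H ≤ G cyclic}` is a ℤ-module isomorphism from `V(G)` onto
`⊕_{H ≤ G cyclic} Ṽ(H)` (it is well defined into the direct sum, injective, and surjective;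
it is ℤ-linear by definition since it is given by restriction). -/
theorem stmt2 {G : Type*} [AddCommGroup G]
    (htor : ∀ g : G, IsOfFinAddOrder g)
    (h2 : ∀ g : G, g + g = 0 → g = 0) :
    (∀ μ : G → ℤ, memV μ →
      (∀ H : {H : AddSubgroup G // ∃ g : G, H = AddSubgroup.zmultiples g},
        memTildeV H.1 ((gens H.1).indicator μ)) ∧
      {H : {H : AddSubgroup G // ∃ g : G, H = AddSubgroup.zmultiples g} |
        (gens H.1).indicator μ ≠ 0}.Finite) ∧
    (∀ μ ν : G → ℤ, memV μ → memV ν →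
      (∀ H : {H : AddSubgroup G // ∃ g : G, H = AddSubgroup.zmultiples g},
        (gens H.1).indicator μ = (gens H.1).indicator ν) → μ = ν) ∧
    (∀ f : {H : AddSubgroup G // ∃ g : G, H = AddSubgroup.zmultiples g} → (G → ℤ),
      (∀ H, memTildeV H.1 (f H)) →
      {H : {H : AddSubgroup G // ∃ g : G, H = AddSubgroup.zmultiples g} | f H ≠ 0}.Finite →
      ∃ μ : G → ℤ, memV μ ∧
        ∀ H : {H : AddSubgroup G // ∃ g : G, H = AddSubgroup.zmultiples g},
          (gens H.1).indicator μ = f H) := by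
  have hneg : ∀ g : G, AddSubgroup.zmultiples (-g) = AddSubgroup.zmultiples g :=
    fun _ => AddSubgroup.zmultiples_neg
  have hdbl : ∀ g : G, AddSubgroup.zmultiples (g + g) = AddSubgroup.zmultiples g :=
    fun g => zmultiples_add_self h2 (htor g)
  refine ⟨fun μ ⟨hfin, hrel, hsum⟩ => ⟨?_, ?_⟩, fun μ ν _ _ h => ?_, fun f hf hfin => ?_⟩
  · rintro ⟨_, y, rfl⟩
    refine ⟨fun g hg => Set.indicator_of_notMem hg _, fun g hg => ?_, ?_⟩
    · have hg' := mem_gens.mp hg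
      rw [Set.indicator_of_mem hg, Set.indicator_of_mem (mem_gens.mpr ((hneg g).trans hg')),
        Set.indicator_of_mem (mem_gens.mpr ((hdbl g).trans hg')),
        Set.indicator_of_mem (mem_gens.mpr ((hneg _).trans ((hdbl g).trans hg')))]
      exact hrel g
    · rw [← finsum_mem_gens_eq_zero htor hfin hsum y]
      exact finsum_mem_congr rfl fun x hx => Set.indicator_of_mem hx _
  · refine (hfin.image fun g => ⟨AddSubgroup.zmultiples g, g, rfl⟩).subset fun H hH => ?_
    obtain ⟨g, hg⟩ := Function.ne_iff.mp hH
    obtain ⟨hgH, hg0⟩ := Set.indicator_apply_ne_zero.mp hg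
    exact ⟨g, hg0, Subtype.ext hgH⟩
  · funext g
    simpa [Set.indicator_of_mem (mem_gens.mpr rfl : g ∈ gens (AddSubgroup.zmultiples g))] using
      congrFun (h ⟨AddSubgroup.zmultiples g, g, rfl⟩) g
  · let μ : G → ℤ := fun g => f ⟨AddSubgroup.zmultiples g, g, rfl⟩ g
    have hμ : ∀ H : {H : AddSubgroup G // ∃ g : G, H = AddSubgroup.zmultiples g},
        ∀ g ∈ gens H.1, μ g = f H g := by
      rintro H g hg
      exact congrArg (fun K => f K g) (Subtype.ext hg)
    have hsupp : (Function.support μ).Finite := by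
      refine (hfin.biUnion (t := fun H => (H.1 : Set G)) fun H _ => ?_).subset fun g hg => ?_
      · obtain ⟨_, y, rfl⟩ := H
        exact finite_zmultiples.mpr (htor y)
      · exact Set.mem_biUnion (x := ⟨AddSubgroup.zmultiples g, g, rfl⟩)
          (fun h => hg (congrFun h g)) (AddSubgroup.mem_zmultiples g)
    refine ⟨μ, ⟨hsupp, fun g => ?_, fun H => ?_⟩, fun H => ?_⟩
    · have h := (hf ⟨AddSubgroup.zmultiples g, g, rfl⟩).2.1 g rfl
      rwa [← hμ ⟨_, g, rfl⟩ g rfl, ← hμ ⟨_, g, rfl⟩ (-g) (hneg g),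
        ← hμ ⟨_, g, rfl⟩ (g + g) (hdbl g),
        ← hμ ⟨_, g, rfl⟩ (-(g + g)) ((hneg _).trans (hdbl g))] at h
    · refine finsum_mem_subgroup_eq_zero hsupp H fun g _ => ?_
      rw [← (hf ⟨AddSubgroup.zmultiples g, g, rfl⟩).2.2]
      exact finsum_mem_congr rfl fun x hx => hμ ⟨AddSubgroup.zmultiples g, g, rfl⟩ x hx
    · funext g
      by_cases hg : g ∈ gens H.1
      · rw [Set.indicator_of_mem hg, hμ H g hg]
      · rw [Set.indicator_of_notMem hg, (hf H).1 g hg]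
end

section
/- Let G be an abelian group with no elements of order 2 and let G_T be its torsion subgroup. Then the map μ ↦ (μ|_{G_T}, μ|_{G∖G_T}) defines a ℤ-module isomorphism from V(G) onto V(G_T) ⊕ W, where W is the group of functions μ : G∖G_T → ℤ with finite support satisfying μ(g)+μ(−g)=0 for all g ∈ G∖G_T. -/
open scoped BigOperators

/-- `W`: finitely supported functions on `G ∖ G_T` (encoded as functions on `G` vanishing on
the torsion part) with `ν(g) + ν(-g) = 0` for all non-torsion `g`. -/
def memW {G : Type*} [AddCommGroup G] (ν : G → ℤ) : Prop :=
  (Function.support ν).Finite ∧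
  (∀ g : G, IsOfFinAddOrder g → ν g = 0) ∧
  (∀ g : G, ¬ IsOfFinAddOrder g → ν g + ν (-g) = 0)

/-- A function that is odd on a set stable under negation has total sum zero on that set. -/
theorem finsum_mem_eq_zero_of_odd {G : Type*} [AddGroup G] {S : Set G} {ν : G → ℤ}
    (hS : ∀ g ∈ S, -g ∈ S) (hν : ∀ g ∈ S, ν g + ν (-g) = 0) :
    ∑ᶠ g ∈ S, ν g = 0 := by
  have h1 : ∑ᶠ g ∈ S, ν g = ∑ᶠ g ∈ S, -ν g := by
    refine finsum_mem_eq_of_bijOn (fun g => -g) ⟨hS, neg_injective.injOn, fun g hg => ?_⟩ ?_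
    · exact ⟨-g, hS g hg, neg_neg g⟩
    · intro g hg
      linarith [hν g hg]
  have h2 : ∑ᶠ g ∈ S, -ν g = -∑ᶠ g ∈ S, ν g := by
    simp only [finsum_mem_def S, ← finsum_neg_distrib]
    congr 1
    ext g
    by_cases hg : g ∈ S <;> simp [hg]
  linarith

theorem isOfFinAddOrder_add_self_iff {G : Type*} [AddMonoid G] {g : G} :
    IsOfFinAddOrder (g + g) ↔ IsOfFinAddOrder g := by
  rw [← two_nsmul, isOfFinAddOrder_nsmul]
  simp

/-- The relation `μ g + μ (-g) = μ (2g) + μ (-2g)` forces a finitely supported function to be odd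
away from the torsion subgroup. -/
theorem memV.add_neg_eq_zero {G : Type*} [AddCommGroup G] {μ : G → ℤ} (hμ : memV μ) {g : G}
    (hg : ¬ IsOfFinAddOrder g) : μ g + μ (-g) = 0 := by
  obtain ⟨hfin, hdouble, -⟩ := hμ
  have hpow : ∀ n : ℕ, μ (2 ^ n • g) + μ (-(2 ^ n • g)) = μ g + μ (-g) := by
    intro n
    induction n with
    | zero => simp
    | succ n ih => rw [pow_succ, mul_nsmul, two_nsmul, ← hdouble, ih]
  have hinj : Function.Injective fun n : ℕ => 2 ^ n • g :=
    (injective_nsmul_iff_not_isOfFinAddOrder.2 hg).comp (Nat.pow_right_injective le_rfl)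
  by_contra hne
  have hsub : Set.range (fun n : ℕ => 2 ^ n • g) ⊆
      Function.support μ ∪ Neg.neg ⁻¹' Function.support μ := by
    rintro _ ⟨n, rfl⟩
    by_contra hn
    simp only [Set.mem_union, Set.mem_preimage, Function.mem_support, not_or, not_not] at hn
    exact hne (by rw [← hpow n, hn.1, hn.2, add_zero])
  exact Set.infinite_range_of_injective hinj
    ((hfin.union (hfin.preimage neg_injective.injOn)).subset hsub)

/-- The map `μ ↦ (μ|_{G_T}, μ|_{G∖G_T})` is a ℤ-module isomorphism from `V(G)` onto
`V(G_T) ⊕ W` (it is well defined, injective, and surjective; it is ℤ-linear by definition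
since it is given by restriction). -/
theorem stmt3 {G : Type*} [AddCommGroup G] (h2 : ∀ g : G, g + g = 0 → g = 0) :
    (∀ μ : G → ℤ, memV μ →
      memV (fun x : ↥(AddCommGroup.torsion G) => μ ↑x) ∧
      memW ({g : G | ¬ IsOfFinAddOrder g}.indicator μ)) ∧
    (∀ μ ν : G → ℤ, memV μ → memV ν →
      (∀ x : ↥(AddCommGroup.torsion G), μ ↑x = ν ↑x) →
      ({g : G | ¬ IsOfFinAddOrder g}.indicator μ = {g : G | ¬ IsOfFinAddOrder g}.indicator ν) →
      μ = ν) ∧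
    (∀ (a : ↥(AddCommGroup.torsion G) → ℤ) (b : G → ℤ), memV a → memW b →
      ∃ μ : G → ℤ, memV μ ∧ (∀ x : ↥(AddCommGroup.torsion G), μ ↑x = a x) ∧
        {g : G | ¬ IsOfFinAddOrder g}.indicator μ = b) := by
  refine ⟨fun μ hμ => ⟨⟨?_, ?_, ?_⟩, ?_, ?_, ?_⟩, ?_, ?_⟩
  · exact hμ.1.preimage Subtype.val_injective.injOn
  · intro g
    exact hμ.2.1 g
  · intro H
    rw [← hμ.2.2 (H.map (AddCommGroup.torsion G).subtype), AddSubgroup.coe_map]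
    exact (finsum_mem_image Subtype.val_injective.injOn).symm
  · exact hμ.1.subset (by rw [Set.support_indicator]; exact Set.inter_subset_right)
  · intro g hg
    exact Set.indicator_of_notMem (not_not.2 hg) μ
  · intro g hg
    rw [Set.indicator_of_mem (show g ∈ {g : G | ¬ IsOfFinAddOrder g} from hg),
      Set.indicator_of_mem (show -g ∈ {g : G | ¬ IsOfFinAddOrder g} from
        fun h => hg (isOfFinAddOrder_neg_iff.1 h))]
    exact hμ.add_neg_eq_zero hg
  · intro μ ν _ _ hT hN
    ext g
    by_cases hg : IsOfFinAddOrder g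
    · exact hT ⟨g, hg⟩
    · simpa [hg] using congrFun hN g
  · intro a b ha hb
    classical
    obtain ⟨μ, hμT, hμN⟩ : ∃ μ : G → ℤ, (∀ x : ↥(AddCommGroup.torsion G), μ ↑x = a x) ∧
        ∀ g : G, ¬ IsOfFinAddOrder g → μ g = b g :=
      ⟨fun g => if h : IsOfFinAddOrder g then a ⟨g, h⟩ else b g,
        fun x => dif_pos x.2, fun g hg => dif_neg hg⟩
    have hodd : ∀ g : G, ¬ IsOfFinAddOrder g → μ g + μ (-g) = 0 := by
      intro g hg
      rw [hμN g hg, hμN (-g) fun h => hg (isOfFinAddOrder_neg_iff.1 h)]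
      exact hb.2.2 g hg
    have hfin : (Function.support μ).Finite := by
      refine ((ha.1.image Subtype.val).union hb.1).subset fun g hg => ?_
      by_cases hgT : IsOfFinAddOrder g
      · exact Or.inl ⟨⟨g, hgT⟩, fun h => hg ((hμT ⟨g, hgT⟩).trans h), rfl⟩
      · exact Or.inr fun h => hg ((hμN g hgT).trans h)
    refine ⟨μ, ⟨hfin, ?_, ?_⟩, hμT, ?_⟩
    · intro g
      by_cases hg : IsOfFinAddOrder g
      · have h := ha.2.1 ⟨g, hg⟩
        simp only [← hμT] at h
        exact h
      · rw [hodd g hg, hodd (g + g) (mt isOfFinAddOrder_add_self_iff.1 hg)]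
    · intro H
      have hT : ∑ᶠ g ∈ (H : Set G) ∩ (AddCommGroup.torsion G : Set G), μ g = 0 := by
        rw [← ha.2.2 (H.comap (AddCommGroup.torsion G).subtype)]
        simp only [← hμT]
        rw [← finsum_mem_image Subtype.val_injective.injOn, Set.inter_comm]
        exact congrArg (fun S : Set G => ∑ᶠ g ∈ S, μ g)
          (Subtype.image_preimage_coe (AddCommGroup.torsion G : Set G) (H : Set G)).symm
      have hN : ∑ᶠ g ∈ (H : Set G) \ (AddCommGroup.torsion G : Set G), μ g = 0 :=
        finsum_mem_eq_zero_of_odd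
          (fun g hg => ⟨H.neg_mem hg.1, fun h => hg.2 (neg_mem_iff.1 h)⟩)
          fun g hg => hodd g hg.2
      rw [← finsum_mem_inter_add_sdiff' (AddCommGroup.torsion G : Set G)
        (hfin.subset Set.inter_subset_right), hT, hN, add_zero]
    · ext g
      by_cases hg : IsOfFinAddOrder g
      · simp [hg, hb.2.1 g hg]
      · simp [hg, hμN g hg]
end

section
/- For n ≥ 3 an odd natural number, the rank of the ℤ-module Ṽ(ℤ/nℤ) equals φ(n)/2 + φ(n)/(2|U_n|) − 1, where φ is Euler's totient function. Moreover, Ṽ(ℤ/1ℤ) has rank 0. -/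
open scoped BigOperators

/-- The minimal `k ≥ 1` such that `2^k ≡ ±1 (mod n)`. -/
noncomputable def Upow (n : ℕ) : ℕ :=
  sInf {k : ℕ | 1 ≤ k ∧ ((2 : ZMod n) ^ k = 1 ∨ (2 : ZMod n) ^ k = -1)}

/-- The set `U_n = {1, 2, 4, …, 2^{k-1}} ⊆ ℤ/nℤ`. -/
noncomputable def Uset (n : ℕ) : Finset (ZMod n) :=
  (Finset.range (Upow n)).image (fun i => (2 : ZMod n) ^ i)

/-- `Ṽ(ℤ/nℤ)` as a ℤ-submodule of `ZMod n → ℤ`: functions supported on `(ℤ/nℤ)ˣ`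
satisfying `ν(g)+ν(-g)=ν(2g)+ν(-2g)` on units and summing to zero. -/
def tildeVM (n : ℕ) [NeZero n] : Submodule ℤ (ZMod n → ℤ) where
  carrier := {ν | (∀ g : ZMod n, ¬ IsUnit g → ν g = 0) ∧
    (∀ g : ZMod n, IsUnit g → ν g + ν (-g) = ν (2 * g) + ν (-(2 * g))) ∧
    ∑ g : ZMod n, ν g = 0}
  add_mem' := by
    rintro a b ⟨ha1, ha2, ha3⟩ ⟨hb1, hb2, hb3⟩
    refine ⟨fun g hg => ?_, fun g hg => ?_, ?_⟩
    · simp only [Pi.add_apply, ha1 g hg, hb1 g hg, add_zero]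
    · have h1 := ha2 g hg
      have h2 := hb2 g hg
      simp only [Pi.add_apply]
      omega
    · simp only [Pi.add_apply, Finset.sum_add_distrib, ha3, hb3, add_zero]
  zero_mem' := ⟨fun g _ => rfl, fun g _ => by simp, by simp⟩
  smul_mem' := by
    rintro c a ⟨ha1, ha2, ha3⟩
    refine ⟨fun g hg => ?_, fun g hg => ?_, ?_⟩
    · simp only [Pi.smul_apply, smul_eq_mul, ha1 g hg, mul_zero]
    · have h1 := ha2 g hg
      simp only [Pi.smul_apply, smul_eq_mul, ← mul_add, h1]
    · simp only [Pi.smul_apply, smul_eq_mul, ← Finset.mul_sum, ha3, mul_zero]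

/-- The subgroup `{1, -1}` of the unit group of `ℤ/nℤ`. -/
abbrev signSubgroup (n : ℕ) : Subgroup (ZMod n)ˣ := Subgroup.zpowers (-1)

/-- The quotient of the unit group of `ℤ/nℤ` by `{1, -1}`. -/
abbrev UnitsModSign (n : ℕ) : Type := (ZMod n)ˣ ⧸ signSubgroup n

/-- The quotient of the unit group of `ℤ/nℤ` by the subgroup generated by `-1` and `w`. -/
abbrev UnitsModSignPowers {n : ℕ} (w : (ZMod n)ˣ) : Type :=
  UnitsModSign n ⧸ Subgroup.zpowers (w : UnitsModSign n)

theorem mem_signSubgroup {n : ℕ} {u : (ZMod n)ˣ} : u ∈ signSubgroup n ↔ u = 1 ∨ u = -1 := by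
  constructor
  · rintro ⟨k, rfl⟩
    rcases Int.even_or_odd k with h | h
    · left; simp [h.neg_one_zpow]
    · right; simp [h.neg_one_zpow]
  · rintro (rfl | rfl)
    · exact one_mem _
    · exact Subgroup.mem_zpowers _

theorem unitsModSign_mk_eq {n : ℕ} {u v : (ZMod n)ˣ} :
    (u : UnitsModSign n) = v ↔ v = u ∨ v = -u := by
  rw [QuotientGroup.eq, mem_signSubgroup, inv_mul_eq_one, inv_mul_eq_iff_eq_mul]
  simp [eq_comm]

theorem unitsModSign_mk_neg {n : ℕ} (u : (ZMod n)ˣ) :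
    ((-u : (ZMod n)ˣ) : UnitsModSign n) = u :=
  unitsModSign_mk_eq.2 (Or.inr (neg_neg u).symm)

theorem units_neg_ne_self {n : ℕ} (h3 : 3 ≤ n) (u : (ZMod n)ˣ) : -u ≠ u := by
  intro h
  have : Fact (2 < n) := ⟨h3⟩
  apply ZMod.neg_one_ne_one (n := n)
  have h' : (-1 : (ZMod n)ˣ) * u = 1 * u := by simpa using h
  simpa using congrArg Units.val (mul_right_cancel h')

theorem card_signSubgroup {n : ℕ} (h3 : 3 ≤ n) : Nat.card (signSubgroup n) = 2 := by
  rw [Nat.card_zpowers]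
  exact orderOf_eq_prime (by simp) (units_neg_ne_self h3 1)

theorem totient_eq_card_unitsModSign_mul_two {n : ℕ} [NeZero n] (h3 : 3 ≤ n) :
    n.totient = Nat.card (UnitsModSign n) * 2 := by
  rw [← ZMod.card_units_eq_totient, ← Nat.card_eq_fintype_card,
    Subgroup.card_eq_card_quotient_mul_card_subgroup (signSubgroup n), card_signSubgroup h3]

theorem unitsModSign_pow_eq_one_iff {n : ℕ} (w : (ZMod n)ˣ) (k : ℕ) :
    (w : UnitsModSign n) ^ k = 1 ↔ (w : ZMod n) ^ k = 1 ∨ (w : ZMod n) ^ k = -1 := by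
  rw [← QuotientGroup.mk_pow, QuotientGroup.eq_one_iff, mem_signSubgroup, Units.ext_iff,
    Units.ext_iff]
  simp

theorem Upow_eq_orderOf {n : ℕ} [NeZero n] (w : (ZMod n)ˣ) (hw : (w : ZMod n) = 2) :
    Upow n = orderOf (w : UnitsModSign n) := by
  have hpos : 1 ≤ orderOf (w : UnitsModSign n) :=
    (isOfFinOrder_of_finite (w : UnitsModSign n)).orderOf_pos
  unfold Upow
  simp_rw [← hw, ← unitsModSign_pow_eq_one_iff]
  apply le_antisymm
  · exact Nat.sInf_le ⟨hpos, pow_orderOf_eq_one _⟩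
  · refine le_csInf ⟨_, hpos, pow_orderOf_eq_one _⟩ ?_
    rintro k ⟨hk, hk'⟩
    exact orderOf_le_of_pow_eq_one hk hk'

theorem card_Uset {n : ℕ} [NeZero n] (w : (ZMod n)ˣ) (hw : (w : ZMod n) = 2) :
    (Uset n).card = orderOf (w : UnitsModSign n) := by
  unfold Uset
  rw [Finset.card_image_of_injOn, Finset.card_range, Upow_eq_orderOf w hw]
  intro i hi j hj hij
  simp only [Finset.coe_range, Upow_eq_orderOf w hw] at hi hj
  apply pow_injOn_Iio_orderOf hi hj
  have : w ^ i = w ^ j := Units.ext (by simpa [hw] using hij)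
  simp only [← QuotientGroup.mk_pow, this]

open Classical in
/-- The function on `ℤ/nℤ` which takes the values `a` on chosen representatives of the units
modulo sign, and such that `t` gives the sum of the values at `g` and `-g`. -/
noncomputable def ofSignData {n : ℕ} (w : (ZMod n)ˣ) :
    ((UnitsModSign n → ℤ) × (UnitsModSignPowers w → ℤ)) →ₗ[ℤ] (ZMod n → ℤ) where
  toFun p g := if h : IsUnit g then
      (if (h.unit : UnitsModSign n).out = h.unit then p.1 h.unit
        else p.2 (h.unit : UnitsModSign n) - p.1 h.unit) else 0
  map_add' p q := by
    ext g
    simp only [Prod.fst_add, Prod.snd_add, Pi.add_apply]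
    split_ifs <;> ring
  map_smul' c p := by
    ext g
    simp only [Prod.smul_fst, Prod.smul_snd, Pi.smul_apply, smul_eq_mul, RingHom.id_apply]
    split_ifs <;> ring

section ofSignData

variable {n : ℕ} (w : (ZMod n)ˣ) (p : (UnitsModSign n → ℤ) × (UnitsModSignPowers w → ℤ))

theorem ofSignData_of_not_isUnit {g : ZMod n} (hg : ¬ IsUnit g) : ofSignData w p g = 0 := by
  simp [ofSignData, hg]

theorem ofSignData_of_out_eq {u : (ZMod n)ˣ} (hu : (u : UnitsModSign n).out = u) :
    ofSignData w p u = p.1 u := by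
  simp [ofSignData, hu]

theorem ofSignData_of_out_ne {u : (ZMod n)ˣ} (hu : (u : UnitsModSign n).out ≠ u) :
    ofSignData w p u = p.2 (u : UnitsModSign n) - p.1 u := by
  simp [ofSignData, hu]

theorem unitsModSign_out_mk (u : (ZMod n)ˣ) :
    (u : UnitsModSign n).out = u ∨ (u : UnitsModSign n).out = -u :=
  unitsModSign_mk_eq.1 (QuotientGroup.out_eq' _).symm

theorem ofSignData_add_neg (h3 : 3 ≤ n) (u : (ZMod n)ˣ) :
    ofSignData w p u + ofSignData w p (-u) = p.2 (u : UnitsModSign n) := by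
  have hne := units_neg_ne_self h3 u
  rw [← Units.val_neg]
  rcases unitsModSign_out_mk u with h | h
  · rw [ofSignData_of_out_eq w p h, ofSignData_of_out_ne w p, unitsModSign_mk_neg]
    · ring
    · rw [unitsModSign_mk_neg, h]; exact hne.symm
  · rw [ofSignData_of_out_ne w p (by rw [h]; exact hne), ofSignData_of_out_eq w p,
      unitsModSign_mk_neg]
    · ring
    · rw [unitsModSign_mk_neg, h]

theorem ofSignData_injective (h3 : 3 ≤ n) : Function.Injective (ofSignData w) := by
  intro p q hpq
  have hout (x : UnitsModSign n) : ((x.out : (ZMod n)ˣ) : UnitsModSign n) = x :=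
    QuotientGroup.out_eq' x
  refine Prod.ext (funext fun x => ?_) (funext fun y => ?_)
  · have h := congrFun hpq (x.out : (ZMod n)ˣ)
    rwa [ofSignData_of_out_eq w p (by rw [hout]), ofSignData_of_out_eq w q (by rw [hout]),
      hout] at h
  · obtain ⟨x, rfl⟩ := QuotientGroup.mk_surjective y
    obtain ⟨u, rfl⟩ := QuotientGroup.mk_surjective x
    rw [← ofSignData_add_neg w p h3, ← ofSignData_add_neg w q h3, hpq]

theorem mk_mul_eq (u : (ZMod n)ˣ) :
    (((w * u : (ZMod n)ˣ) : UnitsModSign n) : UnitsModSignPowers w) =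
      ((u : UnitsModSign n) : UnitsModSignPowers w) := by
  rw [mul_comm, QuotientGroup.mk_mul]
  exact QuotientGroup.mk_mul_of_mem _ (Subgroup.mem_zpowers _)

theorem mem_range_ofSignData [NeZero n] (h3 : 3 ≤ n) (μ : ZMod n → ℤ)
    (h0 : ∀ g : ZMod n, ¬ IsUnit g → μ g = 0)
    (hμ : ∀ g : ZMod n, IsUnit g → μ g + μ (-g) = μ (w * g) + μ (-(w * g))) :
    ∃ p, ofSignData w p = μ := by
  let s : UnitsModSign n → ℤ := fun x => μ (x.out : (ZMod n)ˣ) + μ (-(x.out : (ZMod n)ˣ))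
  have hs (u : (ZMod n)ˣ) : s u = μ u + μ (-u) := by
    rcases unitsModSign_out_mk u with h | h
    · simp only [s, h]
    · simp only [s, h, Units.val_neg, neg_neg]; ring
  have hsw (x : UnitsModSign n) : s (x * w) = s x := by
    obtain ⟨u, rfl⟩ := QuotientGroup.mk_surjective x
    rw [← QuotientGroup.mk_mul, hs, hs, hμ u u.isUnit, mul_comm u w, Units.val_mul]
  have hsp (x : UnitsModSign n) (k : ℕ) : s (x * (w : UnitsModSign n) ^ k) = s x := by
    induction k with
    | zero => simp
    | succ k ih => rw [pow_succ, ← mul_assoc, hsw, ih]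
  have hst (x : UnitsModSign n) : s (x : UnitsModSignPowers w).out = s x := by
    obtain ⟨⟨z, hz⟩, hx⟩ :=
      QuotientGroup.mk_out_eq_mul (Subgroup.zpowers (w : UnitsModSign n)) x
    obtain ⟨k, rfl⟩ := mem_powers_iff_mem_zpowers.2 hz
    rw [hx]
    exact hsp x k
  refine ⟨(fun x => μ (x.out : (ZMod n)ˣ), fun y => s y.out), funext fun g => ?_⟩
  by_cases hg : IsUnit g
  · obtain ⟨u, rfl⟩ := hg
    rcases unitsModSign_out_mk u with h | h
    · rw [ofSignData_of_out_eq w _ h]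
      simp only [h]
    · rw [ofSignData_of_out_ne w _ (by rw [h]; exact units_neg_ne_self h3 u)]
      simp only [hst, hs, h, Units.val_neg]
      ring
  · rw [ofSignData_of_not_isUnit w _ hg, h0 g hg]

/-- The sum of all values of the function attached to a pair by `ofSignData`. -/
noncomputable def sumOfSignData [NeZero n] :
    ((UnitsModSign n → ℤ) × (UnitsModSignPowers w → ℤ)) →ₗ[ℤ] ℤ :=
  (∑ g : ZMod n, LinearMap.proj g) ∘ₗ ofSignData w

theorem sumOfSignData_apply [NeZero n] :
    sumOfSignData w p = ∑ g : ZMod n, ofSignData w p g := by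
  simp [sumOfSignData]

theorem tildeVM_eq_map [NeZero n] (h3 : 3 ≤ n) (hw : (w : ZMod n) = 2) :
    tildeVM n = (LinearMap.ker (sumOfSignData w)).map (ofSignData w) := by
  ext μ
  rw [Submodule.mem_map]
  constructor
  · rintro ⟨h0, h1, h2⟩
    obtain ⟨p, rfl⟩ := mem_range_ofSignData w h3 μ h0 (by rwa [hw])
    exact ⟨p, by rwa [LinearMap.mem_ker, sumOfSignData_apply], rfl⟩
  · rintro ⟨p, hp, rfl⟩
    rw [LinearMap.mem_ker, sumOfSignData_apply] at hp
    refine ⟨fun g hg => ofSignData_of_not_isUnit w p hg, ?_, hp⟩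
    rintro _ ⟨u, rfl⟩
    rw [← hw, ← Units.val_mul, ofSignData_add_neg w p h3, ofSignData_add_neg w p h3, mk_mul_eq]

theorem sumOfSignData_ne_zero [NeZero n] : sumOfSignData w ≠ 0 := by
  intro h
  have h1 : sumOfSignData w (fun _ => 1, fun _ => 2) = 0 := by rw [h]; rfl
  rw [sumOfSignData_apply] at h1
  have hu (u : (ZMod n)ˣ) : ofSignData w (fun _ => 1, fun _ => 2) u = 1 := by
    by_cases hu : (u : UnitsModSign n).out = u
    · rw [ofSignData_of_out_eq w _ hu]
    · rw [ofSignData_of_out_ne w _ hu]; norm_num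
  rw [Finset.sum_eq_zero_iff_of_nonneg] at h1
  · have h2 := h1 ((1 : (ZMod n)ˣ) : ZMod n) (Finset.mem_univ _)
    rw [hu] at h2
    exact one_ne_zero h2
  · intro g _
    by_cases hg : IsUnit g
    · obtain ⟨u, rfl⟩ := hg
      rw [hu]; exact zero_le_one
    · rw [ofSignData_of_not_isUnit w _ hg]

theorem finrank_ker_sumOfSignData_add_one [NeZero n] :
    Module.finrank ℤ (LinearMap.ker (sumOfSignData w)) + 1 =
      Nat.card (UnitsModSign n) + Nat.card (UnitsModSignPowers w) := by
  have := Fintype.ofFinite (UnitsModSign n)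
  have := Fintype.ofFinite (UnitsModSignPowers w)
  have h := Submodule.finrank_quotient_add_finrank (LinearMap.ker (sumOfSignData w))
  rw [(sumOfSignData w).quotKerEquivRange.finrank_eq, Module.finrank_prod,
    Module.finrank_pi, Module.finrank_pi, ← Nat.card_eq_fintype_card,
    ← Nat.card_eq_fintype_card] at h
  have hr : Module.finrank ℤ (LinearMap.range (sumOfSignData w)) = 1 := by
    apply le_antisymm
    · simpa using Submodule.finrank_le (LinearMap.range (sumOfSignData w))
    · rw [Nat.one_le_iff_ne_zero, Ne, Submodule.finrank_eq_zero, LinearMap.range_eq_bot]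
      exact sumOfSignData_ne_zero w
  omega

end ofSignData

theorem tildeVM_one_eq_bot : tildeVM 1 = ⊥ := by
  rw [eq_bot_iff]
  rintro μ ⟨-, -, h⟩
  refine funext fun g => ?_
  rw [Fintype.sum_subsingleton _ g] at h
  exact h

theorem stmt4 (n : ℕ) [NeZero n] (h3 : 3 ≤ n) (hodd : Odd n) :
    Module.rank ℤ ↥(tildeVM n) =
      ((Nat.totient n / 2 + Nat.totient n / (2 * (Uset n).card) - 1 : ℕ) : Cardinal) ∧
    Module.rank ℤ ↥(tildeVM 1) = 0 := by
  have h2 : IsUnit (2 : ZMod n) := by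
    rw [← Nat.cast_ofNat, ZMod.isUnit_iff_coprime]
    exact (Nat.coprime_two_left).2 hodd
  obtain ⟨w, hw⟩ := h2
  refine ⟨?_, by rw [tildeVM_one_eq_bot, rank_bot]⟩
  have hfin : Module.finrank ℤ (tildeVM n) + 1 =
      Nat.card (UnitsModSign n) + Nat.card (UnitsModSignPowers w) := by
    rw [← finrank_ker_sumOfSignData_add_one w, tildeVM_eq_map w h3 hw,
      ← (Submodule.equivMapOfInjective _ (ofSignData_injective w h3) _).finrank_eq]
  have hcard : Nat.card (UnitsModSign n) =
      Nat.card (UnitsModSignPowers w) * orderOf (w : UnitsModSign n) := by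
    rw [Subgroup.card_eq_card_quotient_mul_card_subgroup
      (Subgroup.zpowers (w : UnitsModSign n)), Nat.card_zpowers]
  rw [← Module.finrank_eq_rank, card_Uset w hw]
  congr 1
  have hdiv : n.totient / (2 * orderOf (w : UnitsModSign n)) =
      Nat.card (UnitsModSignPowers w) := by
    apply Nat.div_eq_of_eq_mul_left 
      (Nat.mul_pos two_pos (isOfFinOrder_of_finite (w : UnitsModSign n)).orderOf_pos)
    rw [totient_eq_card_unitsModSign_mul_two h3, hcard]
    ring
  rw [hdiv, totient_eq_card_unitsModSign_mul_two h3, Nat.mul_div_cancel _ two_pos]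
  omega
end

section
/- Let G₁, G₂ be abelian groups with no elements of order 2, and let ψ : G₁ → G₂ be a group homomorphism with finite kernel. If μ ∈ V(G₂), then the pullback ψ^*μ := μ ∘ ψ belongs to V(G₁). -/
open scoped BigOperators

/-- The preimage of a finite set under a homomorphism with finite kernel is finite. -/
theorem AddMonoidHom.finite_preimage_of_finite_ker {A B : Type*} [AddGroup A] [AddGroup B]
    (f : A →+ B) (hker : (f.ker : Set A).Finite) {s : Set B} (hs : s.Finite) :
    (f ⁻¹' s).Finite := by
  refine hs.preimage' fun b _ => ?_
  rcases (f ⁻¹' {b}).eq_empty_or_nonempty with h | ⟨a, ha⟩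
  · simp [h]
  · refine (hker.image (a + ·)).subset fun x hx => ⟨-a + x, ?_, by simp⟩
    simp_all [AddMonoidHom.mem_ker]

/-- Summing over a subgroup a function pulled back along a homomorphism amounts to summing over
the image, weighted by the size of the kernel. -/
theorem AddMonoidHom.finsum_mem_comp {A B : Type*} [AddGroup A] [AddGroup B]
    (f : A →+ B) (hker : (f.ker : Set A).Finite) {μ : B → ℤ} (hμ : μ.support.Finite)
    (H : AddSubgroup A) :
    ∑ᶠ a ∈ (H : Set A), μ (f a) =
      (Nat.card (f.ker ⊓ H : AddSubgroup A) : ℤ) * ∑ᶠ b ∈ (H.map f : Set B), μ b := by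
  classical
  have hfin : (Function.support (μ ∘ f)).Finite := f.finite_preimage_of_finite_ker hker hμ
  have hS : ((H : Set A) ∩ Function.support (μ ∘ f)).Finite := hfin.inter_of_right _
  have himage : ((H.map f : Set B) ∩ Function.support μ) = ↑(hS.toFinset.image f) := by
    ext b
    simp only [Finset.coe_image, Set.Finite.coe_toFinset, Set.mem_inter_iff, Set.mem_image,
      AddSubgroup.coe_map, Function.mem_support, Function.comp_apply]
    grind
  rw [← finsum_mem_inter_support (f := μ), himage, finsum_mem_coe_finset,
    ← finsum_mem_inter_support (f := fun a => μ (f a)), Finset.mul_sum]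
  change ∑ᶠ a ∈ (H : Set A) ∩ Function.support (μ ∘ f), μ (f a) = _
  rw [finsum_mem_eq_finite_toFinset_sum _ hS, Finset.sum_comp]
  refine Finset.sum_congr rfl fun b hb => ?_
  obtain ⟨a, ha, rfl⟩ := Finset.mem_image.mp hb
  simp only [Set.Finite.mem_toFinset, Set.mem_inter_iff, SetLike.mem_coe, Function.mem_support,
    Function.comp_apply] at ha
  rw [nsmul_eq_mul]
  congr 2
  rw [← Fintype.card_coe, ← Nat.card_eq_fintype_card]
  refine Nat.card_congr ⟨fun x => ⟨-a + x, ?_⟩, fun x => ⟨a + x, ?_⟩, fun x => by simp,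
    fun x => by simp⟩
  · have hx := x.2
    simp only [Finset.mem_filter, Set.Finite.mem_toFinset, Set.mem_inter_iff,
      SetLike.mem_coe] at hx
    exact ⟨by simp [hx.2], H.add_mem (H.neg_mem ha.1) hx.1.1⟩
  · have hk : f x = 0 := x.2.1
    have hxH : (x : A) ∈ H := x.2.2
    simp [hk, ha.2, H.add_mem ha.1 hxH]

theorem stmt7 {G₁ G₂ : Type*} [AddCommGroup G₁] [AddCommGroup G₂]
    (h1 : ∀ g : G₁, g + g = 0 → g = 0) (h2 : ∀ g : G₂, g + g = 0 → g = 0)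
    (ψ : G₁ →+ G₂) (hker : (ψ.ker : Set G₁).Finite)
    (μ : G₂ → ℤ) (hμ : memV μ) :
    memV (μ ∘ ψ) := by
  obtain ⟨hfin, hdouble, hsum⟩ := hμ
  refine ⟨ψ.finite_preimage_of_finite_ker hker hfin, fun g => ?_, fun H => ?_⟩
  · simpa using hdouble (ψ g)
  · simp only [Function.comp_apply]
    rw [ψ.finsum_mem_comp hker hfin H, hsum, mul_zero]
end
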